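/- arXiv:1810.01131 — 3 statements merged into one kernel-verified Lean document; each statement's English description precedes it below -/
import Mathlib

section
/- (Stroh's Theorem) For n > 2: dim_ℂ(S_{n,g}/Dec_{n,g}) equals the number of tuples (k₂,…,kₙ) ∈ ℕ^{n−1} with 2k₂+3k₃+⋯+nkₙ = g − (2^{n−1}−1) when g ≥ 2^{n−1}−1, and equals 0 when g < 2^{n−1}−1 (equivalently, it is the coefficient of x^g in x^{2^{n−1}−1}/((1−x²)(1−x³)⋯(1−xⁿ))). For n = 2, dim_ℂ(S_{2,g}/Dec_{2,g}) = 1 if g is even and g > 0, and 0 otherwise. For n = 1, dim_ℂ(S_{1,g}/Dec_{1,g}) = 1 if g = 0, and 0 otherwise. -/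
open MvPolynomial

noncomputable section

/-- `R_{n,g}`: the ℂ-span of the monomials of degree `n` and weight `g` in
`R = ℂ[a₀,a₁,…] = MvPolynomial ℕ ℂ` (with `aᵢ = X i`). -/
def Rng (n g : ℕ) : Submodule ℂ (MvPolynomial ℕ ℂ) :=
  Submodule.span ℂ {p : MvPolynomial ℕ ℂ | ∃ m : ℕ →₀ ℕ,
    (m.sum fun _ e => e) = n ∧ (m.sum fun i e => i * e) = g ∧ p = monomial m 1}

/-- `S_{n,g} = (ker D) ∩ R_{n,g}`: the `U`-invariants of degree `n` and weight `g`. -/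
def Sng (D : Derivation ℂ (MvPolynomial ℕ ℂ) (MvPolynomial ℕ ℂ)) (n g : ℕ) :
    Submodule ℂ (MvPolynomial ℕ ℂ) :=
  LinearMap.ker (D : MvPolynomial ℕ ℂ →ₗ[ℂ] MvPolynomial ℕ ℂ) ⊓ Rng n g

/-- `Dec_{n,g} = ∑_{h=1}^{n-1} ∑_{j=0}^{g} S_{h,j}·S_{n-h,g-j}`: the decomposable
`U`-invariants of degree `n` and weight `g`. -/
def Dec (D : Derivation ℂ (MvPolynomial ℕ ℂ) (MvPolynomial ℕ ℂ)) (n g : ℕ) :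
    Submodule ℂ (MvPolynomial ℕ ℂ) :=
  ⨆ h ∈ Finset.Icc 1 (n - 1), ⨆ j ∈ Finset.range (g + 1),
    Sng D h j * Sng D (n - h) (g - j)

/-- The number of tuples `(k₂,…,kₙ) ∈ ℕ^{n-1}` with `2k₂+3k₃+⋯+nkₙ = g`. -/
def NN (n g : ℕ) : ℕ :=
  ((Fintype.piFinset fun _ : Fin (n - 1) => Finset.range (g + 1)).filter
    (fun k => ∑ i : Fin (n - 1), ((i : ℕ) + 2) * k i = g)).card

/-- The generating series `∑ aᵢ cⁱ tⁱ`. -/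
def genSeries (c : ℂ) : PowerSeries (MvPolynomial ℕ ℂ) :=
  PowerSeries.mk fun i => C (c ^ i) * X i

/-- The coefficient of `t ^ g` in `∏_{c ∈ s} ∑ aᵢ cⁱ tⁱ`. -/
def genCoeff (s : Multiset ℂ) (g : ℕ) : MvPolynomial ℕ ℂ :=
  PowerSeries.coeff g (s.map genSeries).prod

theorem genCoeff_univ {n : ℕ} (c : Fin n → ℂ) (g : ℕ) :
    genCoeff (Finset.univ.val.map c) g = ∑ m ∈ Finset.finsuppAntidiag Finset.univ g,
      (∏ i, c i ^ m i) • ∏ i, (X (m i) : MvPolynomial ℕ ℂ) := by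
  classical
  have h : ((Finset.univ.val.map c).map genSeries).prod = ∏ i, genSeries (c i) := by
    rw [Multiset.map_map]; rfl
  rw [genCoeff, h, PowerSeries.coeff_prod]
  refine Finset.sum_congr (by congr!) fun m _ => ?_
  simp only [genSeries, PowerSeries.coeff_mk, Finset.prod_mul_distrib, smul_eq_C_mul, map_prod]

theorem exists_eq_univ_map {α : Type*} (s : Multiset α) {n : ℕ} (hs : s.card = n) :
    ∃ c : Fin n → α, Finset.univ.val.map c = s := by
  subst hs
  refine ⟨fun i => s.toList.get (i.cast (by simp)), ?_⟩
  conv_rhs => rw [← s.coe_toList]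
  rw [Fin.univ_val_map]
  congr 1
  apply List.ext_get <;> simp

theorem genCoeff_add (s t : Multiset ℂ) (g : ℕ) :
    genCoeff (s + t) g = ∑ j ∈ Finset.range (g + 1), genCoeff s j * genCoeff t (g - j) := by
  rw [genCoeff, Multiset.map_add, Multiset.prod_add, PowerSeries.coeff_mul,
    Finset.Nat.sum_antidiagonal_eq_sum_range_succ_mk]
  rfl

theorem genCoeff_map_mul (z : ℂ) (s : Multiset ℂ) (g : ℕ) :
    genCoeff (s.map (z * ·)) g = z ^ g • genCoeff s g := by
  have h : ((s.map (z * ·)).map genSeries).prod =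
      PowerSeries.rescale (C z) (s.map genSeries).prod := by
    rw [map_multiset_prod, Multiset.map_map, Multiset.map_map]
    congr 2
    funext c
    ext1 i
    simp [genSeries, mul_pow, mul_assoc]
  rw [genCoeff, h, PowerSeries.coeff_rescale, smul_eq_C_mul, map_pow, genCoeff]

section Derivation

variable (D : Derivation ℂ (MvPolynomial ℕ ℂ) (MvPolynomial ℕ ℂ))

theorem mk_derivation_mul (p q : PowerSeries (MvPolynomial ℕ ℂ)) :
    (PowerSeries.mk fun g => D (PowerSeries.coeff g (p * q))) =
      (PowerSeries.mk fun g => D (PowerSeries.coeff g p)) * q +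
        p * PowerSeries.mk fun g => D (PowerSeries.coeff g q) := by
  ext1 g
  simp only [PowerSeries.coeff_mk, PowerSeries.coeff_mul, map_add, map_sum, Derivation.leibniz,
    smul_eq_mul, ← Finset.sum_add_distrib]
  exact Finset.sum_congr rfl fun x _ => by ring

variable {D}

theorem mk_derivation_prod (hD0 : D (X 0) = 0) (hD : ∀ i : ℕ, D (X (i + 1)) = X i)
    (s : Multiset ℂ) :
    (PowerSeries.mk fun g => D (PowerSeries.coeff g (s.map genSeries).prod)) =
      PowerSeries.C (C s.sum) * PowerSeries.X * (s.map genSeries).prod := by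
  induction s using Multiset.induction_on with
  | empty =>
    ext1 g
    simp only [Multiset.map_zero, Multiset.prod_zero, PowerSeries.coeff_mk, Multiset.sum_zero,
      map_zero, zero_mul, PowerSeries.coeff_one]
    split_ifs <;> simp
  | cons c s ih =>
    have h : (PowerSeries.mk fun g => D (PowerSeries.coeff g (genSeries c))) =
        PowerSeries.C (C c) * PowerSeries.X * genSeries c := by
      ext1 g
      rw [mul_assoc, PowerSeries.coeff_C_mul]
      cases g with
      | zero => simp [genSeries, hD0]
      | succ g =>
        rw [PowerSeries.coeff_succ_X_mul]
        simp only [genSeries, PowerSeries.coeff_mk, ← smul_eq_C_mul, Derivation.map_smul, hD,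
          smul_smul, pow_succ']
    rw [Multiset.map_cons, Multiset.prod_cons, mk_derivation_mul, ih, h, Multiset.sum_cons,
      map_add, map_add]
    ring

theorem derivation_genCoeff_zero (hD0 : D (X 0) = 0) (hD : ∀ i : ℕ, D (X (i + 1)) = X i)
    (s : Multiset ℂ) : D (genCoeff s 0) = 0 := by
  have h := congrArg (PowerSeries.coeff 0) (mk_derivation_prod hD0 hD s)
  simpa [mul_assoc, genCoeff] using h

theorem derivation_genCoeff_succ (hD0 : D (X 0) = 0) (hD : ∀ i : ℕ, D (X (i + 1)) = X i)
    (s : Multiset ℂ) (g : ℕ) : D (genCoeff s (g + 1)) = s.sum • genCoeff s g := by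
  have h := congrArg (PowerSeries.coeff (g + 1)) (mk_derivation_prod hD0 hD s)
  rw [mul_assoc, PowerSeries.coeff_C_mul, PowerSeries.coeff_succ_X_mul, PowerSeries.coeff_mk] at h
  rw [smul_eq_C_mul]
  exact h

theorem derivation_genCoeff_eq_zero (hD0 : D (X 0) = 0) (hD : ∀ i : ℕ, D (X (i + 1)) = X i)
    {s : Multiset ℂ} (hs : s.sum = 0) (g : ℕ) : D (genCoeff s g) = 0 := by
  cases g with
  | zero => exact derivation_genCoeff_zero hD0 hD s
  | succ g => rw [derivation_genCoeff_succ hD0 hD, hs, zero_smul]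

end Derivation

theorem prod_X_eq_monomial {n : ℕ} (m : Fin n →₀ ℕ) :
    ∏ i, (X (m i) : MvPolynomial ℕ ℂ) = monomial (∑ i, Finsupp.single (m i) 1) 1 := by
  rw [monomial_sum_one]; rfl

theorem exists_sum_single (μ : ℕ →₀ ℕ) :
    ∃ m : Fin (μ.sum fun _ e => e) →₀ ℕ, ∑ i, Finsupp.single (m i) 1 = μ := by
  obtain ⟨m, hm⟩ := exists_eq_univ_map (Finsupp.toMultiset μ) (Finsupp.card_toMultiset μ)
  refine ⟨Finsupp.equivFunOnFinite.symm m,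
    Function.LeftInverse.injective Finsupp.toMultiset_toFinsupp ?_⟩
  rw [← hm, map_sum]
  simp only [Finsupp.equivFunOnFinite_symm_apply_apply, Finsupp.toMultiset_single, one_smul]
  rw [Finset.sum_eq_multiset_sum, ← Multiset.sum_map_singleton (Finset.univ.val.map m),
    Multiset.map_map]
  rfl

theorem sum_single_sum {n : ℕ} (m : Fin n →₀ ℕ) :
    ((∑ i, Finsupp.single (m i) 1 : ℕ →₀ ℕ).sum fun _ e => e) = n := by
  rw [← Finsupp.sum_finsetSum_index (by simp) (by simp)]
  simp

theorem sum_single_weight {n : ℕ} (m : Fin n →₀ ℕ) :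
    ((∑ i, Finsupp.single (m i) 1 : ℕ →₀ ℕ).sum fun i e => i * e) = ∑ i, m i := by
  rw [← Finsupp.sum_finsetSum_index (by simp) (by simp [mul_add])]
  simp

theorem exists_perm_of_sum_single {n : ℕ} {m m' : Fin n →₀ ℕ}
    (h : (∑ i, Finsupp.single (m i) 1 : ℕ →₀ ℕ) = ∑ i, Finsupp.single (m' i) 1) :
    ∃ σ : Equiv.Perm (Fin n), ∀ i, m' (σ i) = m i := by
  classical
  have key : ∀ c, Fintype.card {i // m i = c} = Fintype.card {i // m' i = c} := by
    intro c
    have := DFunLike.congr_fun h c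
    simpa [Finsupp.single_apply, Fintype.card_subtype] using this
  exact ⟨Equiv.ofFiberEquiv fun c => Fintype.equivOfCardEq (key c),
    fun i => Equiv.ofFiberEquiv_map _ i⟩

theorem Rng_le_span (n g : ℕ) :
    Rng n g = Submodule.span ℂ ((fun m : Fin n →₀ ℕ => ∏ i, (X (m i) : MvPolynomial ℕ ℂ)) ''
      {m | ∑ i, m i = g}) := by
  rw [Rng]
  congr 1
  ext p
  constructor
  · rintro ⟨μ, rfl, hμ, rfl⟩
    obtain ⟨m, hm⟩ := exists_sum_single μ
    refine ⟨m, ?_, ?_⟩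
    · change ∑ i, m i = g
      rw [← sum_single_weight, hm, hμ]
    · simp only [prod_X_eq_monomial, hm]
  · rintro ⟨m, hm, rfl⟩
    exact ⟨_, sum_single_sum m, (sum_single_weight m).trans hm, prod_X_eq_monomial m⟩

theorem genCoeff_mem_Rng {n : ℕ} {s : Multiset ℂ} (hs : s.card = n) (g : ℕ) :
    genCoeff s g ∈ Rng n g := by
  obtain ⟨c, rfl⟩ := exists_eq_univ_map s hs
  rw [genCoeff_univ, Rng_le_span]
  refine Submodule.sum_mem _ fun m hm => Submodule.smul_mem _ _ (Submodule.subset_span ⟨m, ?_, rfl⟩)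
  exact (Finset.mem_finsuppAntidiag.1 hm).1

/-- The polynomial whose value at `c` is `ℓ (genCoeff c g)`. -/
def dualPoly (n g : ℕ) (ℓ : MvPolynomial ℕ ℂ →ₗ[ℂ] ℂ) : MvPolynomial (Fin n) ℂ :=
  ∑ m ∈ Finset.finsuppAntidiag Finset.univ g, monomial m (ℓ (∏ i, X (m i)))

theorem eval_dualPoly {n : ℕ} (c : Fin n → ℂ) (g : ℕ) (ℓ : MvPolynomial ℕ ℂ →ₗ[ℂ] ℂ) :
    eval c (dualPoly n g ℓ) = ℓ (genCoeff (Finset.univ.val.map c) g) := by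
  rw [dualPoly, genCoeff_univ, map_sum, map_sum]
  refine Finset.sum_congr rfl fun m _ => ?_
  rw [eval_monomial, Finsupp.prod_fintype _ _ (by simp), map_smul, smul_eq_mul, mul_comm]

theorem coeff_dualPoly {n : ℕ} {g : ℕ} (ℓ : MvPolynomial ℕ ℂ →ₗ[ℂ] ℂ) {m : Fin n →₀ ℕ}
    (hm : ∑ i, m i = g) : coeff m (dualPoly n g ℓ) = ℓ (∏ i, X (m i)) := by
  classical
  rw [dualPoly, coeff_sum]
  simp only [coeff_monomial]
  rw [Finset.sum_ite_eq' (Finset.finsuppAntidiag Finset.univ g) m, if_pos]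
  simp [Finset.mem_finsuppAntidiag, hm]

theorem isHomogeneous_dualPoly (n g : ℕ) (ℓ : MvPolynomial ℕ ℂ →ₗ[ℂ] ℂ) :
    (dualPoly n g ℓ).IsHomogeneous g := by
  refine IsHomogeneous.sum _ _ _ fun m hm => isHomogeneous_monomial _ ?_
  rw [Finsupp.degree_eq_sum]
  exact (Finset.mem_finsuppAntidiag.1 hm).1

theorem isSymmetric_dualPoly (n g : ℕ) (ℓ : MvPolynomial ℕ ℂ →ₗ[ℂ] ℂ) :
    (dualPoly n g ℓ).IsSymmetric := by
  intro e
  refine MvPolynomial.funext fun c => ?_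
  rw [eval_rename, eval_dualPoly, eval_dualPoly, ← Multiset.map_map,
    Multiset.map_univ_val_equiv]

theorem exists_dualPoly_eq {n g : ℕ} {f : MvPolynomial (Fin n) ℂ} (hs : f.IsSymmetric)
    (hf : f.IsHomogeneous g) : ∃ ℓ, dualPoly n g ℓ = f := by
  classical
  let v : (ℕ →₀ ℕ) → ℂ := fun μ =>
    if h : ∃ m : Fin n →₀ ℕ, ∑ i, Finsupp.single (m i) 1 = μ then coeff h.choose f else 0
  have hv : ∀ m : Fin n →₀ ℕ, v (∑ i, Finsupp.single (m i) 1) = coeff m f := by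
    intro m
    have h : ∃ m' : Fin n →₀ ℕ, ∑ i, (Finsupp.single (m' i) 1 : ℕ →₀ ℕ) =
      ∑ i, Finsupp.single (m i) 1 := ⟨m, rfl⟩
    simp only [v, dif_pos h]
    obtain ⟨σ, hσ⟩ := exists_perm_of_sum_single h.choose_spec.symm
    have : h.choose = m.mapDomain σ := by
      ext i
      obtain ⟨j, rfl⟩ := σ.surjective i
      rw [hσ, Finsupp.mapDomain_apply σ.injective]
    conv_lhs => rw [this, ← hs σ, coeff_rename_mapDomain _ σ.injective]
  refine ⟨(basisMonomials ℕ ℂ).constr ℂ v, ?_⟩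
  ext m
  by_cases hm : ∑ i, m i = g
  · rw [coeff_dualPoly _ hm, prod_X_eq_monomial, ← hv]
    exact (basisMonomials ℕ ℂ).constr_basis ℂ v _
  · rw [(isHomogeneous_dualPoly _ _ _).coeff_eq_zero, hf.coeff_eq_zero] <;>
      rwa [Finsupp.degree_eq_sum]

section LinearForm

variable {σ : Type*}

theorem eval_aeval {τ : Type*} (y : τ → ℂ) (s : σ → MvPolynomial τ ℂ) (p : MvPolynomial σ ℂ) :
    eval y (aeval s p) = eval (fun i => eval y (s i)) p := by
  induction p using MvPolynomial.induction_on with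
  | C a => simp
  | add p q hp hq => rw [map_add, map_add, map_add, hp, hq]
  | mul_X p i hp => rw [map_mul, map_mul, map_mul, hp, aeval_X, eval_X]

theorem sum_X_dvd_iff {J : Finset σ} (hJ : J.Nonempty) {p : MvPolynomial σ ℂ} :
    (∑ j ∈ J, X j) ∣ p ↔ ∀ y : σ → ℂ, ∑ j ∈ J, y j = 0 → eval y p = 0 := by
  classical
  constructor
  · rintro ⟨q, rfl⟩ y hy
    simp [hy]
  · intro h
    obtain ⟨j₀, hj₀⟩ := hJ
    set L : MvPolynomial σ ℂ := ∑ j ∈ J, X j with hL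
    let s : σ → MvPolynomial σ ℂ := fun i => X i - if i = j₀ then L else 0
    have h0 : aeval s p = 0 := by
      refine MvPolynomial.funext fun y => ?_
      rw [map_zero, eval_aeval]
      refine h _ ?_
      simp only [s, map_sub, eval_X, Finset.sum_sub_distrib, apply_ite (eval y), map_zero,
        Finset.sum_ite_eq', if_pos hj₀]
      simp [hL]
    have h1 : Ideal.Quotient.mk (Ideal.span {L}) p =
        Ideal.Quotient.mk (Ideal.span {L}) (aeval s p) := by
      have : (Ideal.Quotient.mkₐ ℂ (Ideal.span {L})).comp (aeval s) =
          Ideal.Quotient.mkₐ ℂ (Ideal.span {L}) := by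
        refine algHom_ext fun i => ?_
        rw [AlgHom.comp_apply, aeval_X, Ideal.Quotient.mkₐ_eq_mk, Ideal.Quotient.eq,
          Ideal.mem_span_singleton]
        dsimp only [s]
        split_ifs <;> simp
      exact (DFunLike.congr_fun this p).symm
    rw [h0, map_zero, Ideal.Quotient.eq_zero_iff_mem, Ideal.mem_span_singleton] at h1
    exact h1

theorem sum_X_ne_zero {J : Finset σ} (hJ : J.Nonempty) :
    (∑ j ∈ J, X j : MvPolynomial σ ℂ) ≠ 0 := by
  intro h
  have := congrArg (eval fun _ => (1 : ℂ)) h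
  simp [hJ.ne_empty] at this

theorem isHomogeneous_sum_X (J : Finset σ) :
    (∑ j ∈ J, X j : MvPolynomial σ ℂ).IsHomogeneous 1 :=
  IsHomogeneous.sum _ _ _ fun _ _ => isHomogeneous_X _ _

theorem irreducible_sum_X {J : Finset σ} (hJ : J.Nonempty) :
    Irreducible (∑ j ∈ J, X j : MvPolynomial σ ℂ) := by
  refine irreducible_of_totalDegree_eq_one
    ((isHomogeneous_sum_X J).totalDegree (sum_X_ne_zero hJ)) fun x hx => ?_
  rw [isUnit_iff_ne_zero]
  rintro rfl
  refine sum_X_ne_zero hJ (MvPolynomial.ext _ _ fun m => ?_)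
  rw [coeff_zero]
  exact zero_dvd_iff.1 (hx m)

theorem isRelPrime_sum_X {J K : Finset σ} (hJ : J.Nonempty) (hK : K.Nonempty) (hJK : J ≠ K) :
    IsRelPrime (∑ j ∈ J, X j : MvPolynomial σ ℂ) (∑ j ∈ K, X j) := by
  classical
  rw [(irreducible_sum_X hJ).isRelPrime_iff_not_dvd, sum_X_dvd_iff hJ]
  intro h
  by_cases hKJ : K ⊆ J
  · obtain ⟨j, hj, hjK⟩ := Finset.exists_of_ssubset (hKJ.ssubset_of_ne hJK.symm)
    obtain ⟨k, hk⟩ := hK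
    have := h (Pi.single k 1 - Pi.single j 1) (by simp [Finset.sum_pi_single', hj, hKJ hk])
    simp [Finset.sum_pi_single', hk, hjK] at this
  · obtain ⟨k, hk, hkJ⟩ := Finset.not_subset.1 hKJ
    have := h (Pi.single k 1) (by simp [Finset.sum_pi_single', hkJ])
    simp [Finset.sum_pi_single', hk] at this

end LinearForm

theorem homogeneousComponent_mul_add {σ : Type*} {L : MvPolynomial σ ℂ} {d : ℕ}
    (hL : L.IsHomogeneous d) (u : MvPolynomial σ ℂ) (m : ℕ) :
    homogeneousComponent (d + m) (L * u) = L * homogeneousComponent m u := by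
  classical
  conv_lhs => rw [← sum_homogeneousComponent u, Finset.mul_sum, map_sum]
  have (i : ℕ) : homogeneousComponent (d + m) (L * homogeneousComponent i u) =
      if i = m then L * homogeneousComponent m u else 0 := by
    rw [homogeneousComponent_of_mem (hL.mul (homogeneousComponent_isHomogeneous i u))]
    rcases eq_or_ne i m with rfl | h
    · simp
    · rw [if_neg (by omega), if_neg h]
  simp only [this, Finset.sum_ite_eq', Finset.mem_range]
  split_ifs with h
  · rfl
  · rw [homogeneousComponent_eq_zero _ _ (by omega), mul_zero]

/-- A cofactor of a homogeneous polynomial in a homogeneous polynomial is homogeneous. -/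
theorem isHomogeneous_of_mul {σ : Type*} {L u : MvPolynomial σ ℂ} {d m : ℕ}
    (hL : L.IsHomogeneous d) (hL0 : L ≠ 0) (hu : (L * u).IsHomogeneous (d + m)) :
    u.IsHomogeneous m := by
  have h := homogeneousComponent_mul_add hL u m
  rw [homogeneousComponent_eq_self hu] at h
  rw [mul_left_cancel₀ hL0 h]
  exact homogeneousComponent_isHomogeneous m u

theorem eq_zero_of_mul_isHomogeneous {σ : Type*} {L u : MvPolynomial σ ℂ} {d g : ℕ}
    (hL : L.IsHomogeneous d) (hu : (L * u).IsHomogeneous g) (hg : g < d) : L * u = 0 := by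
  classical
  rw [← sum_homogeneousComponent u, Finset.mul_sum]
  refine Finset.sum_eq_zero fun i _ => ?_
  rw [← homogeneousComponent_mul_add hL, homogeneousComponent_of_mem hu, if_neg (by omega)]

theorem isSymmetric_of_mul {σ : Type*} {L u : MvPolynomial σ ℂ} (hL : L.IsSymmetric)
    (hL0 : L ≠ 0) (hu : (L * u).IsSymmetric) : u.IsSymmetric := by
  intro e
  have h := hu e
  rw [map_mul, hL e] at h
  exact mul_left_cancel₀ hL0 h

theorem isSymmetric_sum_X {σ : Type*} [Fintype σ] :
    (∑ i, X i : MvPolynomial σ ℂ).IsSymmetric := by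
  intro e
  simp only [map_sum, rename_X]
  exact Equiv.sum_comp e fun i => (X i : MvPolynomial σ ℂ)

section Span

variable {D : Derivation ℂ (MvPolynomial ℕ ℂ) (MvPolynomial ℕ ℂ)}

theorem genCoeff_mem_Sng (hD0 : D (X 0) = 0) (hD : ∀ i : ℕ, D (X (i + 1)) = X i) {n : ℕ}
    {s : Multiset ℂ} (hs : s.card = n) (hs0 : s.sum = 0) (g : ℕ) : genCoeff s g ∈ Sng D n g :=
  ⟨derivation_genCoeff_eq_zero hD0 hD hs0 g, genCoeff_mem_Rng hs g⟩

theorem eq_zero_of_mem_Rng {n g : ℕ} {ℓ : MvPolynomial ℕ ℂ →ₗ[ℂ] ℂ}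
    (hℓ : ∀ c : Fin n → ℂ, ℓ (genCoeff (Finset.univ.val.map c) g) = 0)
    {p : MvPolynomial ℕ ℂ} (hp : p ∈ Rng n g) : ℓ p = 0 := by
  have h : dualPoly n g ℓ = 0 := MvPolynomial.funext fun c => by rw [eval_dualPoly, hℓ, map_zero]
  rw [Rng_le_span] at hp
  refine (Submodule.span_le (p := LinearMap.ker ℓ)).2 ?_ hp
  rintro _ ⟨m, hm, rfl⟩
  change ℓ _ = 0
  rw [← coeff_dualPoly ℓ hm, h, coeff_zero]

theorem sum_univ_map {n : ℕ} (c : Fin n → ℂ) : (Finset.univ.val.map c).sum = ∑ i, c i := rfl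

theorem eq_zero_of_mem_Sng (hD0 : D (X 0) = 0) (hD : ∀ i : ℕ, D (X (i + 1)) = X i) {n g : ℕ}
    {ℓ : MvPolynomial ℕ ℂ →ₗ[ℂ] ℂ}
    (hℓ : ∀ c : Fin n → ℂ, ∑ i, c i = 0 → ℓ (genCoeff (Finset.univ.val.map c) g) = 0)
    {p : MvPolynomial ℕ ℂ} (hp : p ∈ Sng D n g) : ℓ p = 0 := by
  rcases Nat.eq_zero_or_pos n with rfl | hn
  · exact eq_zero_of_mem_Rng (fun c => hℓ c (by simp)) hp.2
  have hne : (Finset.univ : Finset (Fin n)).Nonempty := ⟨⟨0, hn⟩, Finset.mem_univ _⟩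
  obtain ⟨h, hh⟩ : (∑ i, X i) ∣ dualPoly n g ℓ :=
    (sum_X_dvd_iff hne).2 fun c hc => by rw [eval_dualPoly, hℓ c hc]
  have hhom := isHomogeneous_dualPoly n g ℓ
  have hsym := isSymmetric_dualPoly n g ℓ
  rw [hh] at hhom hsym
  have hsym' := isSymmetric_of_mul isSymmetric_sum_X (sum_X_ne_zero hne) hsym
  cases g with
  | zero =>
    refine eq_zero_of_mem_Rng (fun c => ?_) hp.2
    rw [← eval_dualPoly, hh, eq_zero_of_mul_isHomogeneous (isHomogeneous_sum_X _) hhom one_pos,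
      map_zero]
  | succ g =>
    rw [add_comm] at hhom
    obtain ⟨ℓ', rfl⟩ := exists_dualPoly_eq hsym'
      (isHomogeneous_of_mul (isHomogeneous_sum_X _) (sum_X_ne_zero hne) hhom)
    have key := eq_zero_of_mem_Rng (ℓ := ℓ - ℓ' ∘ₗ D.toLinearMap) (n := n) (g := g + 1)
      (fun c => ?_) hp.2
    · have hDp : D p = 0 := hp.1
      simpa [hDp] using key
    · have hD' : D.toLinearMap (genCoeff (Finset.univ.val.map c) (g + 1)) = _ :=
        derivation_genCoeff_succ hD0 hD _ g
      rw [LinearMap.sub_apply, LinearMap.comp_apply, hD', ← eval_dualPoly, hh, map_mul,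
        eval_dualPoly, map_smul, sum_univ_map]
      simp

theorem Sng_eq_span (hD0 : D (X 0) = 0) (hD : ∀ i : ℕ, D (X (i + 1)) = X i) (n g : ℕ) :
    Sng D n g = Submodule.span ℂ
      ((fun s => genCoeff s g) '' {s : Multiset ℂ | s.card = n ∧ s.sum = 0}) := by
  apply le_antisymm
  · intro p hp
    by_contra hps
    obtain ⟨ℓ, hℓp, hℓ⟩ := Submodule.exists_le_ker_of_notMem hps
    refine hℓp (eq_zero_of_mem_Sng hD0 hD (fun c hc => ?_) hp)
    exact hℓ (Submodule.subset_span ⟨_, ⟨by simp, hc⟩, rfl⟩)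
  · rw [Submodule.span_le]
    rintro _ ⟨s, ⟨hs, hs0⟩, rfl⟩
    exact genCoeff_mem_Sng hD0 hD hs hs0 g

theorem genCoeff_add_mem_Dec (hD0 : D (X 0) = 0) (hD : ∀ i : ℕ, D (X (i + 1)) = X i) {n : ℕ}
    {s t : Multiset ℂ} (hn : (s + t).card = n) (hs : s ≠ 0) (ht : t ≠ 0)
    (hs0 : s.sum = 0) (ht0 : t.sum = 0) (g : ℕ) : genCoeff (s + t) g ∈ Dec D n g := by
  rw [genCoeff_add]
  rw [← Multiset.card_pos] at hs ht
  rw [Multiset.card_add] at hn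
  refine Submodule.sum_mem _ fun j hj => ?_
  refine Submodule.mem_iSup_of_mem s.card (Submodule.mem_iSup_of_mem
    (Finset.mem_Icc.2 (by omega)) (Submodule.mem_iSup_of_mem j (Submodule.mem_iSup_of_mem hj ?_)))
  exact Submodule.mul_mem_mul (genCoeff_mem_Sng hD0 hD rfl hs0 j)
    (genCoeff_mem_Sng hD0 hD (by omega) ht0 _)

theorem Dec_le_ker (hD0 : D (X 0) = 0) (hD : ∀ i : ℕ, D (X (i + 1)) = X i) {n g : ℕ}
    {ℓ : MvPolynomial ℕ ℂ →ₗ[ℂ] ℂ}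
    (hℓ : ∀ s t : Multiset ℂ, (s + t).card = n → s ≠ 0 → t ≠ 0 → s.sum = 0 → t.sum = 0 →
      ℓ (genCoeff (s + t) g) = 0) : Dec D n g ≤ LinearMap.ker ℓ := by
  refine iSup₂_le fun h hh => iSup₂_le fun j hj => ?_
  rw [Sng_eq_span hD0 hD, Sng_eq_span hD0 hD, Submodule.span_mul_span, Submodule.span_le]
  rintro _ ⟨_, ⟨s, ⟨hs, hs0⟩, rfl⟩, _, ⟨t, ⟨ht, ht0⟩, rfl⟩, rfl⟩
  rw [Finset.mem_Icc] at hh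
  change ℓ (genCoeff s j * genCoeff t (g - j)) = 0
  let q : Polynomial ℂ := ∑ i ∈ Finset.range (g + 1),
    Polynomial.monomial i (ℓ (genCoeff s i * genCoeff t (g - i)))
  have hq : q = 0 := by
    refine Polynomial.funext fun z => ?_
    have h0 := hℓ (s.map (z * ·)) t (by simp [hs, ht]; omega)
      (by rw [← Multiset.card_pos, Multiset.card_map]; omega) (by rw [← Multiset.card_pos]; omega)
      (by rw [Multiset.sum_map_mul_left]; simp [hs0]) ht0
    rw [genCoeff_add, map_sum] at h0
    rw [Polynomial.eval_zero, ← h0, Polynomial.eval_finsetSum]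
    refine Finset.sum_congr rfl fun i _ => ?_
    rw [genCoeff_map_mul, smul_mul_assoc, map_smul, Polynomial.eval_monomial, smul_eq_mul, mul_comm]
  have := congrArg (fun q => Polynomial.coeff q j) hq
  simpa [q, Polynomial.finsetSum_coeff, Polynomial.coeff_monomial,
    Finset.mem_range.1 hj] using this

end Span

theorem exists_finset_map_eq (s t : Multiset ℂ) {k : ℕ} (hk : (s + t).card = k) :
    ∃ (y : Fin k → ℂ) (J : Finset (Fin k)), J.val.map y = s ∧ Finset.univ.val.map y = s + t := by
  obtain ⟨c, hc⟩ := exists_eq_univ_map (n := k)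
    (s.map (fun a => (a, true)) + t.map (fun a => (a, false))) (by simpa using hk)
  refine ⟨fun i => (c i).1, Finset.univ.filter fun i => (c i).2 = true, ?_, ?_⟩
  · have h := congrArg (fun u => (u.filter fun x : ℂ × Bool => x.2 = true).map Prod.fst) hc
    simpa [-Fin.univ_val_map, Multiset.filter_map, Multiset.filter_add, Function.comp_def] using h
  · have h := congrArg (Multiset.map Prod.fst) hc
    simpa [Function.comp_def] using h

section Restriction

/-- Restriction of polynomials to the hyperplane `∑ xᵢ = 0`, in the coordinates `x₁, …, x_k`. -/
def restr (k : ℕ) : MvPolynomial (Fin (k + 1)) ℂ →ₐ[ℂ] MvPolynomial (Fin k) ℂ :=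
  aeval (Fin.cons (-∑ i, X i) X)

variable {k : ℕ}

theorem restr_X_zero : restr k (X 0) = -∑ i, X i := by simp [restr]

theorem restr_X_succ (i : Fin k) : restr k (X i.succ) = X i := by simp [restr]

theorem restr_sum_X : restr k (∑ i, X i) = 0 := by
  rw [map_sum, Fin.sum_univ_succ]
  simp [restr_X_zero, restr_X_succ]

/-- The point of the hyperplane `∑ xᵢ = 0` with last coordinates `y`. -/
def hyperplanePoint (y : Fin k → ℂ) : Fin (k + 1) → ℂ := Fin.cons (-∑ i, y i) y

theorem sum_hyperplanePoint (y : Fin k → ℂ) : ∑ i, hyperplanePoint y i = 0 := by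
  simp [hyperplanePoint, Fin.sum_univ_succ]

theorem hyperplanePoint_tail {c : Fin (k + 1) → ℂ} (hc : ∑ i, c i = 0) :
    hyperplanePoint (Fin.tail c) = c := by
  rw [Fin.sum_univ_succ] at hc
  conv_rhs => rw [← Fin.cons_self_tail c]
  rw [hyperplanePoint, eq_neg_of_add_eq_zero_left hc]
  rfl

theorem map_hyperplanePoint (y : Fin k → ℂ) :
    Finset.univ.val.map (hyperplanePoint y) = (-∑ i, y i) ::ₘ Finset.univ.val.map y := by
  simp [hyperplanePoint, Fin.univ_succ, Function.comp_def]

theorem eval_restr (y : Fin k → ℂ) (f : MvPolynomial (Fin (k + 1)) ℂ) :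
    eval y (restr k f) = eval (hyperplanePoint y) f := by
  rw [restr, eval_aeval]
  congr 2
  funext i
  refine Fin.cases ?_ (fun i => ?_) i <;> simp [hyperplanePoint]

theorem isHomogeneous_restr {f : MvPolynomial (Fin (k + 1)) ℂ} {g : ℕ} (hf : f.IsHomogeneous g) :
    (restr k f).IsHomogeneous g := by
  rw [← one_mul g]
  refine hf.aeval _ fun i => ?_
  refine Fin.cases ?_ (fun i => ?_) i
  · exact (isHomogeneous_sum_X _).neg
  · exact isHomogeneous_X _ _

/-- The product of the sums of variables over nonempty subsets. -/
def subsetSumProd (k : ℕ) : MvPolynomial (Fin k) ℂ :=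
  ∏ J ∈ Finset.univ.filter (fun J : Finset (Fin k) => J.Nonempty), ∑ j ∈ J, X j

theorem subsetSumProd_dvd_iff {p : MvPolynomial (Fin k) ℂ} :
    subsetSumProd k ∣ p ↔
      ∀ J : Finset (Fin k), J.Nonempty → ∀ y : Fin k → ℂ, ∑ j ∈ J, y j = 0 → eval y p = 0 := by
  constructor
  · intro h J hJ
    exact (sum_X_dvd_iff hJ).1 ((Finset.dvd_prod_of_mem (fun J => ∑ j ∈ J, X j)
      (Finset.mem_filter.2 ⟨Finset.mem_univ J, hJ⟩)).trans h)
  · intro h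
    rw [subsetSumProd]
    refine Finset.prod_dvd_of_isRelPrime (s := fun J : Finset (Fin k) => ∑ j ∈ J, X j) ?_ ?_
    · intro J hJ K hK hJK
      rw [Finset.mem_coe, Finset.mem_filter] at hJ hK
      exact isRelPrime_sum_X hJ.2 hK.2 hJK
    · intro J hJ
      exact (sum_X_dvd_iff (Finset.mem_filter.1 hJ).2).2 (h J (Finset.mem_filter.1 hJ).2)

/-- Restrictions to `∑ xᵢ = 0` of symmetric forms of degree `g`. -/
def restrSymm (k g : ℕ) : Submodule ℂ (MvPolynomial (Fin k) ℂ) :=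
  (Subalgebra.toSubmodule (symmetricSubalgebra (Fin (k + 1)) ℂ) ⊓
    homogeneousSubmodule (Fin (k + 1)) ℂ g).map (restr k).toLinearMap

/-- Restrictions to `∑ xᵢ = 0` of symmetric forms of degree `g`, which vanish at points having
a proper nonempty family of coordinates with zero sum. -/
def restrSymmVanishing (k g : ℕ) : Submodule ℂ (MvPolynomial (Fin k) ℂ) :=
  restrSymm k g ⊓ (Ideal.span {subsetSumProd k}).restrictScalars ℂ

theorem mem_restrSymm {g : ℕ} {p : MvPolynomial (Fin k) ℂ} :
    p ∈ restrSymm k g ↔ ∃ f : MvPolynomial (Fin (k + 1)) ℂ,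
      (f.IsSymmetric ∧ f.IsHomogeneous g) ∧ restr k f = p := Iff.rfl

theorem mem_restrSymmVanishing {g : ℕ} {p : MvPolynomial (Fin k) ℂ} :
    p ∈ restrSymmVanishing k g ↔ p ∈ restrSymm k g ∧ subsetSumProd k ∣ p := by
  rw [restrSymmVanishing, Submodule.mem_inf, Submodule.restrictScalars_mem,
    Ideal.mem_span_singleton]

variable {D : Derivation ℂ (MvPolynomial ℕ ℂ) (MvPolynomial ℕ ℂ)}

/-- The invariant of degree `k + 1` and weight `g` attached to a point of `∑ xᵢ = 0`. -/
def invariantAt (hD0 : D (X 0) = 0) (hD : ∀ i : ℕ, D (X (i + 1)) = X i) (g : ℕ)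
    (y : Fin k → ℂ) : Sng D (k + 1) g :=
  ⟨genCoeff (Finset.univ.val.map (hyperplanePoint y)) g,
    genCoeff_mem_Sng hD0 hD (by simp) (sum_hyperplanePoint y) g⟩

theorem subsetSumProd_dvd_restr_dualPoly (hD0 : D (X 0) = 0) (hD : ∀ i : ℕ, D (X (i + 1)) = X i)
    {g : ℕ} {ℓ : MvPolynomial ℕ ℂ →ₗ[ℂ] ℂ} :
    subsetSumProd k ∣ restr k (dualPoly (k + 1) g ℓ) ↔
      Dec D (k + 1) g ⊓ Sng D (k + 1) g ≤ LinearMap.ker ℓ := by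
  rw [subsetSumProd_dvd_iff]
  constructor
  · intro h
    refine inf_le_left.trans (Dec_le_ker hD0 hD ?_)
    intro s t hk hs ht hs0 ht0
    obtain ⟨b, hb⟩ := Multiset.exists_mem_of_ne_zero ht
    obtain ⟨t, rfl⟩ := Multiset.exists_cons_of_mem hb
    obtain ⟨y, J, hJ, hy⟩ := exists_finset_map_eq s t (k := k) (by simp at hk ⊢; omega)
    have hb0 : b = -∑ i, y i := by
      rw [Multiset.sum_cons] at ht0
      rw [← sum_univ_map, hy, Multiset.sum_add, hs0, zero_add, eq_neg_of_add_eq_zero_left ht0]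
    have := h J (by
      rw [Finset.nonempty_iff_ne_empty]
      rintro rfl
      exact hs hJ.symm) y (by rw [← hs0, ← hJ]; rfl)
    rwa [eval_restr, eval_dualPoly, map_hyperplanePoint, hy, ← hb0, ← Multiset.add_cons] at this
  · intro h J hJ y hy
    rw [eval_restr, eval_dualPoly]
    have hsplit : Finset.univ.val.map (hyperplanePoint y) =
        J.val.map y + ((-∑ i, y i) ::ₘ (Jᶜ).val.map y) := by
      rw [map_hyperplanePoint, Multiset.add_cons, ← Multiset.map_add]
      congr 2
      rw [← Finset.disjUnion_val J Jᶜ disjoint_compl_right, Finset.disjUnion_eq_union,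
        Finset.union_compl]
    have hs0 : (J.val.map y).sum = 0 := hy
    refine h ⟨?_, (invariantAt hD0 hD g y).2⟩
    rw [hsplit]
    refine genCoeff_add_mem_Dec hD0 hD ?_ ?_ (by simp) hs0 ?_ g
    · rw [← hsplit]; simp
    · simpa using hJ.ne_empty
    · have := sum_hyperplanePoint y
      rw [← sum_univ_map, hsplit, Multiset.sum_add, hs0, zero_add] at this
      exact this

theorem finrank_quotient_eq (hD0 : D (X 0) = 0) (hD : ∀ i : ℕ, D (X (i + 1)) = X i) (g : ℕ) :
    Module.finrank ℂ (↥(Sng D (k + 1) g) ⧸ (Dec D (k + 1) g).comap (Sng D (k + 1) g).subtype) =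
      Module.finrank ℂ (restrSymmVanishing k g) := by
  let N := (Dec D (k + 1) g).comap (Sng D (k + 1) g).subtype
  let ev : MvPolynomial (Fin k) ℂ →ₗ[ℂ] (Fin k → ℂ) → ℂ :=
    LinearMap.pi fun y => (aeval y).toLinearMap
  have ev_apply (p y) : ev p y = eval y p := by
    simp [ev, aeval_eq_eval]
  have hev : Function.Injective ev := fun p q h =>
    MvPolynomial.funext fun y => by rw [← ev_apply, h, ev_apply]
  let Θ : Module.Dual ℂ (↥(Sng D (k + 1) g) ⧸ N) →ₗ[ℂ] (Fin k → ℂ) → ℂ :=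
    LinearMap.pi fun y => Module.Dual.eval ℂ _ (N.mkQ (invariantAt hD0 hD g y))
  have lift (ℓ : Module.Dual ℂ (↥(Sng D (k + 1) g) ⧸ N)) :
      ∃ ℓ' : MvPolynomial ℕ ℂ →ₗ[ℂ] ℂ, ∀ p, ℓ' p.1 = ℓ (N.mkQ p) := by
    obtain ⟨ℓ', hℓ'⟩ := (ℓ ∘ₗ N.mkQ).exists_extend
    exact ⟨ℓ', fun p => DFunLike.congr_fun hℓ' p⟩
  have hΘ : Function.Injective Θ := by
    rw [injective_iff_map_eq_zero]
    intro ℓ hℓ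
    obtain ⟨ℓ', hℓ'⟩ := lift ℓ
    refine LinearMap.ext fun p => ?_
    obtain ⟨p, rfl⟩ := N.mkQ_surjective p
    rw [← hℓ']
    refine eq_zero_of_mem_Sng hD0 hD (fun c hc => ?_) p.2
    have := congrFun hℓ (Fin.tail c)
    change ℓ (N.mkQ _) = 0 at this
    rw [← hℓ'] at this
    simpa only [invariantAt, hyperplanePoint_tail hc] using this
  have hrange : LinearMap.range Θ = (restrSymmVanishing k g).map ev := by
    ext u
    constructor
    · rintro ⟨ℓ, rfl⟩
      obtain ⟨ℓ', hℓ'⟩ := lift ℓ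
      refine ⟨restr k (dualPoly (k + 1) g ℓ'), mem_restrSymmVanishing.2
        ⟨⟨_, ⟨isSymmetric_dualPoly _ _ _, isHomogeneous_dualPoly _ _ _⟩, rfl⟩, ?_⟩, ?_⟩
      · refine (subsetSumProd_dvd_restr_dualPoly hD0 hD).2 fun p hp => ?_
        rw [LinearMap.mem_ker, hℓ' ⟨p, hp.2⟩, N.mkQ_apply, (Submodule.Quotient.mk_eq_zero N).2 hp.1,
          map_zero]
      · funext y
        rw [ev_apply, eval_restr, eval_dualPoly]
        exact hℓ' (invariantAt hD0 hD g y)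
    · rintro ⟨_, hp, rfl⟩
      obtain ⟨⟨f, ⟨hfs, hfh⟩, rfl⟩, hdvd⟩ := mem_restrSymmVanishing.1 hp
      obtain ⟨ℓ', rfl⟩ := exists_dualPoly_eq hfs hfh
      have hN : N ≤ LinearMap.ker (ℓ' ∘ₗ (Sng D (k + 1) g).subtype) := fun p hp =>
        (subsetSumProd_dvd_restr_dualPoly hD0 hD).1 hdvd ⟨hp, p.2⟩
      refine ⟨N.liftQ _ hN, ?_⟩
      funext y
      change _ = ev (restr k (dualPoly (k + 1) g ℓ')) y
      rw [ev_apply, eval_restr, eval_dualPoly]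
      rfl
  rw [← Subspace.dual_finrank_eq, ← LinearMap.finrank_range_of_inj hΘ, hrange]
  exact (LinearEquiv.finrank_eq (Submodule.equivMapOfInjective ev hev _)).symm

end Restriction

section Count

variable {k : ℕ}

theorem isHomogeneous_aeval_of_isWeightedHomogeneous {σ τ : Type*} {w : σ → ℕ}
    {s : σ → MvPolynomial τ ℂ} (hs : ∀ i, (s i).IsHomogeneous (w i)) {F : MvPolynomial σ ℂ} {g : ℕ}
    (hF : F.IsWeightedHomogeneous w g) : (aeval s F).IsHomogeneous g := by
  rw [aeval_def, eval₂_eq]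
  refine IsHomogeneous.sum _ _ _ fun m hm => ?_
  rw [algebraMap_eq]
  refine IsHomogeneous.C_mul ?_ _
  have hw := hF (mem_support_iff.1 hm)
  rw [Finsupp.weight_apply, Finsupp.sum] at hw
  rw [← hw]
  refine IsHomogeneous.prod _ _ _ fun i _ => ?_
  rw [smul_eq_mul, mul_comm]
  exact (hs i).pow _

theorem homogeneousComponent_aeval {σ τ : Type*} {w : σ → ℕ} {s : σ → MvPolynomial τ ℂ}
    (hs : ∀ i, (s i).IsHomogeneous (w i)) (g : ℕ) (F : MvPolynomial σ ℂ) :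
    homogeneousComponent g (aeval s F) = aeval s (weightedHomogeneousComponent w g F) := by
  classical
  induction F using MvPolynomial.induction_on' with
  | monomial m a =>
    have hm := isWeightedHomogeneous_monomial w m a rfl
    rw [homogeneousComponent_of_mem (isHomogeneous_aeval_of_isWeightedHomogeneous hs hm),
      weightedHomogeneousComponent_of_mem hm]
    split_ifs
    · rfl
    · rw [map_zero]
  | add p q hp hq => rw [map_add, map_add, map_add, map_add, hp, hq]

theorem isHomogeneous_esymm (σ : Type*) [Fintype σ] (d : ℕ) :
    (esymm σ ℂ d).IsHomogeneous d := by
  rw [esymm]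
  refine IsHomogeneous.sum _ _ _ fun t ht => ?_
  have := IsHomogeneous.prod t (fun i => (X i : MvPolynomial σ ℂ)) (fun _ => 1)
    fun i _ => isHomogeneous_X _ _
  simpa [(Finset.mem_powersetCard.1 ht).2] using this

/-- Restrictions to `∑ xᵢ = 0` of polynomials in the elementary symmetric polynomials
`e₂, …, e_{k+1}`. -/
def aevalRestrEsymm (k : ℕ) : MvPolynomial (Fin k) ℂ →ₐ[ℂ] MvPolynomial (Fin k) ℂ :=
  aeval fun i => restr k (esymm (Fin (k + 1)) ℂ (i + 2))

theorem restr_aeval_esymm (F : MvPolynomial (Fin (k + 1)) ℂ) :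
    restr k (aeval (fun i : Fin (k + 1) => esymm (Fin (k + 1)) ℂ (i + 1)) F) =
      aevalRestrEsymm k (aeval (Fin.cons 0 X : Fin (k + 1) → MvPolynomial (Fin k) ℂ) F) := by
  have h : (restr k).comp (aeval fun i : Fin (k + 1) => esymm (Fin (k + 1)) ℂ (i + 1)) =
      (aevalRestrEsymm k).comp (aeval (Fin.cons 0 X)) := by
    refine algHom_ext fun i => ?_
    rw [AlgHom.comp_apply, AlgHom.comp_apply, aeval_X, aeval_X]
    refine Fin.cases ?_ (fun i => ?_) i
    · simpa [esymm_one] using restr_sum_X (k := k)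
    · simp [aevalRestrEsymm]
  exact DFunLike.congr_fun h F

theorem aeval_cons_rename_succ (G : MvPolynomial (Fin k) ℂ) :
    aeval (Fin.cons 0 X : Fin (k + 1) → MvPolynomial (Fin k) ℂ) (rename Fin.succ G) = G := by
  rw [aeval_rename]
  simp [Function.comp_def]

theorem isSymmetric_aeval_esymm {n : ℕ} (F : MvPolynomial (Fin n) ℂ) :
    (aeval (fun i : Fin n => esymm (Fin n) ℂ (i + 1)) F).IsSymmetric := by
  rw [← esymmAlgHom_apply]
  exact (esymmAlgHom (Fin n) ℂ n _).2

theorem exists_aeval_esymm_eq {n : ℕ} {f : MvPolynomial (Fin n) ℂ} (hf : f.IsSymmetric) :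
    ∃ F : MvPolynomial (Fin n) ℂ, aeval (fun i : Fin n => esymm (Fin n) ℂ (i + 1)) F = f := by
  obtain ⟨F, hF⟩ := (esymmAlgEquiv (Fin n) ℂ (Fintype.card_fin n)).surjective ⟨f, hf⟩
  refine ⟨F, ?_⟩
  rw [← esymmAlgHom_apply]
  exact congrArg Subtype.val hF

theorem aeval_esymm_injective (n : ℕ) :
    Function.Injective (aeval (R := ℂ) fun i : Fin n => esymm (Fin n) ℂ (i + 1)) := by
  intro F G h
  rw [← esymmAlgHom_apply, ← esymmAlgHom_apply] at h
  exact (esymmAlgEquiv (Fin n) ℂ (Fintype.card_fin n)).injective (Subtype.ext h)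

theorem sum_X_dvd_of_restr_eq_zero {f : MvPolynomial (Fin (k + 1)) ℂ} (hf : restr k f = 0) :
    ∑ i, X i ∣ f :=
  (sum_X_dvd_iff Finset.univ_nonempty).2 fun c hc => by
    rw [← hyperplanePoint_tail hc, ← eval_restr, hf, map_zero]

theorem aevalRestrEsymm_injective : Function.Injective (aevalRestrEsymm k) := by
  rw [injective_iff_map_eq_zero]
  intro G hG
  rw [← aeval_cons_rename_succ G, ← restr_aeval_esymm] at hG
  obtain ⟨h, hh⟩ := sum_X_dvd_of_restr_eq_zero hG
  have hsym := isSymmetric_aeval_esymm (rename Fin.succ G)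
  rw [hh] at hsym
  obtain ⟨F, rfl⟩ := exists_aeval_esymm_eq
    (isSymmetric_of_mul isSymmetric_sum_X (sum_X_ne_zero Finset.univ_nonempty) hsym)
  have h0 : (∑ i, X i : MvPolynomial (Fin (k + 1)) ℂ) =
      aeval (fun i : Fin (k + 1) => esymm (Fin (k + 1)) ℂ (i + 1)) (X 0 : MvPolynomial _ ℂ) := by
    simp [esymm_one]
  rw [h0, ← map_mul] at hh
  rw [← aeval_cons_rename_succ G, aeval_esymm_injective _ hh, map_mul]
  simp

theorem restrSymm_eq_map (k g : ℕ) : restrSymm k g =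
    (weightedHomogeneousSubmodule ℂ (fun i : Fin k => (i : ℕ) + 2) g).map
      (aevalRestrEsymm k).toLinearMap := by
  classical
  have hE (i : Fin k) : (restr k (esymm (Fin (k + 1)) ℂ (i + 2))).IsHomogeneous (i + 2) :=
    isHomogeneous_restr (isHomogeneous_esymm _ _)
  ext p
  constructor
  · rintro ⟨f, ⟨hfs, hfh⟩, rfl⟩
    obtain ⟨F, rfl⟩ := exists_aeval_esymm_eq hfs
    have hp := isHomogeneous_restr hfh
    change restr k (aeval _ F) ∈ _
    rw [restr_aeval_esymm] at hp ⊢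
    generalize aeval (Fin.cons 0 X : Fin (k + 1) → MvPolynomial (Fin k) ℂ) F = G at hp ⊢
    refine ⟨weightedHomogeneousComponent _ g G, weightedHomogeneousComponent_mem _ _ _, ?_⟩
    change aevalRestrEsymm k _ = _
    rw [aevalRestrEsymm, ← homogeneousComponent_aeval hE]
    exact homogeneousComponent_eq_self hp
  · rintro ⟨G, hG, rfl⟩
    refine ⟨aeval (fun i : Fin (k + 1) => esymm (Fin (k + 1)) ℂ (i + 1)) (rename Fin.succ G),
      ⟨?_, ?_⟩, ?_⟩
    · exact isSymmetric_aeval_esymm _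
    · rw [aeval_rename]
      exact isHomogeneous_aeval_of_isWeightedHomogeneous (fun i => isHomogeneous_esymm _ _) hG
    · change restr k _ = _
      rw [restr_aeval_esymm, aeval_cons_rename_succ]
      rfl

theorem card_weight_eq (k g : ℕ) :
    Nat.card {d : Fin k →₀ ℕ | Finsupp.weight (fun i : Fin k => (i : ℕ) + 2) d = g} =
      NN (k + 1) g := by
  rw [NN, ← Nat.card_eq_finsetCard]
  refine Nat.card_congr (Finsupp.equivFunOnFinite.subtypeEquiv fun d => ?_)
  rw [Finset.mem_filter, Fintype.mem_piFinset, Set.mem_ofPred_eq, Finsupp.weight_apply,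
    Finsupp.sum_fintype _ _ (by simp)]
  simp only [smul_eq_mul, mul_comm (d _), Finsupp.equivFunOnFinite_apply, Finset.mem_range]
  refine ⟨fun h => ⟨fun i => ?_, h⟩, fun h => h.2⟩
  have := Finset.single_le_sum (f := fun i : Fin k => ((i : ℕ) + 2) * d i)
    (fun _ _ => Nat.zero_le _) (Finset.mem_univ i)
  rw [h] at this
  nlinarith

theorem finrank_restrSymm (k g : ℕ) : Module.finrank ℂ (restrSymm k g) = NN (k + 1) g := by
  rw [restrSymm_eq_map, ← LinearEquiv.finrank_eq (Submodule.equivMapOfInjective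
    (aevalRestrEsymm k).toLinearMap aevalRestrEsymm_injective _),
    weightedHomogeneousSubmodule_eq_finsupp_supported, ← card_weight_eq]
  exact Module.finrank_eq_nat_card_basis (basisRestrictSupport ℂ _)

end Count

section SubsetSumProd

variable {k : ℕ}

theorem subsetSumProd_ne_zero (k : ℕ) : subsetSumProd k ≠ 0 :=
  Finset.prod_ne_zero_iff.2 fun _ hJ => sum_X_ne_zero (Finset.mem_filter.1 hJ).2

theorem isHomogeneous_subsetSumProd (k : ℕ) : (subsetSumProd k).IsHomogeneous (2 ^ k - 1) := by
  have hcard : (Finset.univ.filter fun J : Finset (Fin k) => J.Nonempty).card = 2 ^ k - 1 := by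
    have : (Finset.univ.filter fun J : Finset (Fin k) => J.Nonempty) = Finset.univ.erase ∅ := by
      ext J
      simp [Finset.nonempty_iff_ne_empty]
    rw [this, Finset.card_erase_of_mem (Finset.mem_univ _), Finset.card_univ,
      Fintype.card_finset, Fintype.card_fin]
  have := IsHomogeneous.prod (Finset.univ.filter fun J : Finset (Fin k) => J.Nonempty)
    (fun J => (∑ j ∈ J, X j : MvPolynomial (Fin k) ℂ)) (fun _ => 1)
    fun J _ => isHomogeneous_sum_X J
  rwa [Finset.sum_const, hcard, smul_eq_mul, mul_one] at this

theorem eval_subsetSumProd (y : Fin k → ℂ) : eval y (subsetSumProd k) =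
    ∏ J ∈ Finset.univ.filter (fun J : Finset (Fin k) => J.Nonempty), ∑ j ∈ J, y j := by
  simp [subsetSumProd]

/-- The action of permutations of all `k + 1` coordinates on functions on `∑ xᵢ = 0`, in the
coordinates `x₁, …, x_k`. -/
def permAct (σ : Equiv.Perm (Fin (k + 1))) : MvPolynomial (Fin k) ℂ →ₐ[ℂ] MvPolynomial (Fin k) ℂ :=
  (restr k).comp ((rename σ).comp (rename Fin.succ))

theorem eval_permAct (σ : Equiv.Perm (Fin (k + 1))) (y : Fin k → ℂ) (p : MvPolynomial (Fin k) ℂ) :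
    eval y (permAct σ p) = eval (Fin.tail (hyperplanePoint y ∘ σ)) p := by
  change eval y (restr k (rename σ (rename Fin.succ p))) = _
  rw [eval_restr, eval_rename, eval_rename]
  rfl

theorem permAct_mul (σ τ : Equiv.Perm (Fin (k + 1))) (p : MvPolynomial (Fin k) ℂ) :
    permAct (σ * τ) p = permAct σ (permAct τ p) := by
  refine MvPolynomial.funext fun y => ?_
  rw [eval_permAct, eval_permAct, eval_permAct, hyperplanePoint_tail]
  · rfl
  · exact (Equiv.sum_comp σ _).trans (sum_hyperplanePoint y)

theorem permAct_one (p : MvPolynomial (Fin k) ℂ) : permAct 1 p = p := by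
  refine MvPolynomial.funext fun y => ?_
  rw [eval_permAct]
  rfl

theorem permAct_restr (σ : Equiv.Perm (Fin (k + 1))) (f : MvPolynomial (Fin (k + 1)) ℂ) :
    permAct σ (restr k f) = restr k (rename σ f) := by
  refine MvPolynomial.funext fun y => ?_
  rw [eval_permAct, eval_restr, eval_restr, hyperplanePoint_tail, eval_rename]
  exact (Equiv.sum_comp σ _).trans (sum_hyperplanePoint y)

theorem isHomogeneous_permAct (σ : Equiv.Perm (Fin (k + 1))) {p : MvPolynomial (Fin k) ℂ} {g : ℕ}
    (hp : p.IsHomogeneous g) : (permAct σ p).IsHomogeneous g :=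
  isHomogeneous_restr (hp.rename_isHomogeneous.rename_isHomogeneous)

theorem mem_restrSymm_iff_permAct {g : ℕ} {p : MvPolynomial (Fin k) ℂ} :
    p ∈ restrSymm k g ↔ p.IsHomogeneous g ∧ ∀ σ, permAct σ p = p := by
  rw [mem_restrSymm]
  constructor
  · rintro ⟨f, ⟨hfs, hfh⟩, rfl⟩
    exact ⟨isHomogeneous_restr hfh, fun σ => by rw [permAct_restr, hfs σ]⟩
  · rintro ⟨hp, hσ⟩
    refine ⟨C ((Fintype.card (Equiv.Perm (Fin (k + 1))) : ℂ)⁻¹) *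
      ∑ σ : Equiv.Perm (Fin (k + 1)), rename σ (rename Fin.succ p), ⟨fun τ => ?_, ?_⟩, ?_⟩
    · rw [map_mul, rename_C, map_sum]
      congr 1
      refine Fintype.sum_equiv (Equiv.mulLeft τ) _ _ fun σ => ?_
      rw [rename_rename]
      rfl
    · exact IsHomogeneous.C_mul (IsHomogeneous.sum _ _ _ fun σ _ =>
        hp.rename_isHomogeneous.rename_isHomogeneous) _
    · have h : ∀ σ : Equiv.Perm (Fin (k + 1)), restr k (rename σ (rename Fin.succ p)) = p := hσ
      rw [map_mul, map_sum, Finset.sum_congr rfl fun σ _ => h σ, Finset.sum_const,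
        Finset.card_univ, ← algebraMap_eq, AlgHom.commutes, ← Algebra.smul_def,
        ← Nat.cast_smul_eq_nsmul ℂ, smul_smul, inv_mul_cancel₀, one_smul]
      exact Nat.cast_ne_zero.2 Fintype.card_ne_zero

theorem subsetSumProd_dvd_permAct (σ : Equiv.Perm (Fin (k + 1))) :
    subsetSumProd k ∣ permAct σ (subsetSumProd k) := by
  classical
  refine subsetSumProd_dvd_iff.2 fun J hJ y hy => ?_
  set c := hyperplanePoint y with hc
  suffices h : ∃ I : Finset (Fin (k + 1)), I.Nonempty ∧ (∑ i ∈ I, c i = 0) ∧ σ 0 ∉ I by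
    obtain ⟨I, hI, hI0, h0⟩ := h
    rw [eval_permAct, eval_subsetSumProd]
    refine Finset.prod_eq_zero (i := Finset.univ.filter fun j : Fin k => σ j.succ ∈ I) ?_ ?_
    · obtain ⟨i, hi⟩ := hI
      obtain ⟨j, rfl⟩ := σ.surjective i
      refine Finset.mem_filter.2 ⟨Finset.mem_univ _, ?_⟩
      obtain ⟨j, rfl⟩ := Fin.exists_succ_eq.2 (fun h : j = 0 => h0 (h ▸ hi))
      exact ⟨j, by simpa using hi⟩
    · have h1 : ∑ i, (if σ i ∈ I then c (σ i) else 0) = 0 := by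
        rw [Equiv.sum_comp σ fun i => if i ∈ I then c i else 0]
        simpa using hI0
      rw [Fin.sum_univ_succ, if_neg h0, zero_add] at h1
      rw [Finset.sum_filter]
      exact h1
  have hJc : ∑ i ∈ J.map (Fin.succEmb k), c i = 0 := by
    rw [Finset.sum_map]
    exact hy
  by_cases h : σ 0 ∈ J.map (Fin.succEmb k)
  · refine ⟨(J.map (Fin.succEmb k))ᶜ, ⟨0, by simp [Fin.succ_ne_zero]⟩, ?_, by simpa using h⟩
    have := Finset.sum_add_sum_compl (J.map (Fin.succEmb k)) c
    rwa [hJc, zero_add, hc, sum_hyperplanePoint] at this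
  · exact ⟨_, hJ.map, hJc, h⟩

/-- A point with one special coordinate at which `subsetSumProd` does not vanish. -/
theorem eval_subsetSumProd_ne_zero (l : Fin (k + 1)) :
    eval (Fin.tail fun i => if i = l then (-k : ℂ) else 1) (subsetSumProd k) ≠ 0 := by
  rw [eval_subsetSumProd]
  refine Finset.prod_ne_zero_iff.2 fun J hJ => ?_
  obtain ⟨j₀, hj₀⟩ := (Finset.mem_filter.1 hJ).2
  have hle : J.card ≤ k := by simpa using J.card_le_univ
  have hpos : 0 < J.card := Finset.card_pos.2 ⟨j₀, hj₀⟩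
  by_cases h : ∃ j ∈ J, j.succ = l
  · obtain ⟨j, hj, rfl⟩ := h
    rw [← Finset.add_sum_erase _ _ hj, Finset.sum_congr rfl (g := fun _ => (1 : ℂ))]
    · rw [Finset.sum_const, Finset.card_erase_of_mem hj]
      simp only [Fin.tail, if_true, nsmul_eq_mul, mul_one]
      intro h0
      have : ((J.card - 1 : ℕ) : ℂ) = (k : ℂ) := by linear_combination h0
      have := Nat.cast_injective this
      omega
    · intro i hi
      simp [Fin.tail, Finset.ne_of_mem_erase hi]
  · rw [Finset.sum_congr rfl (g := fun _ => (1 : ℂ))]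
    · simpa using hpos.ne'
    · intro i hi
      exact if_neg fun hil => h ⟨i, hi, hil⟩

theorem permAct_swap_subsetSumProd (hk : 2 ≤ k) (i j : Fin (k + 1)) :
    permAct (Equiv.swap i j) (subsetSumProd k) = subsetSumProd k := by
  obtain ⟨l, hl⟩ : ∃ l, l ∉ ({i, j} : Finset (Fin (k + 1))) := by
    by_contra! h
    have := (Finset.card_le_card fun l (_ : l ∈ Finset.univ) => h l).trans Finset.card_le_two
    simp at this
    omega
  rw [Finset.mem_insert, Finset.mem_singleton, not_or] at hl
  obtain ⟨u, hu⟩ := subsetSumProd_dvd_permAct (Equiv.swap i j)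
  have hu0 : u.IsHomogeneous 0 := by
    refine isHomogeneous_of_mul (isHomogeneous_subsetSumProd k) (subsetSumProd_ne_zero k) ?_
    rw [← hu]
    exact isHomogeneous_permAct _ (isHomogeneous_subsetSumProd k)
  obtain ⟨a, rfl⟩ : ∃ a, u = C a := ⟨_, totalDegree_eq_zero_iff_eq_C.1 (by
    simpa using hu0.totalDegree_le)⟩
  have hsum : ∑ i, (if i = l then (-k : ℂ) else 1) = 0 := by
    rw [← Finset.add_sum_erase _ _ (Finset.mem_univ l), if_pos rfl,
      Finset.sum_congr rfl (g := fun _ => (1 : ℂ)) fun i hi => if_neg (Finset.ne_of_mem_erase hi)]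
    simp
  have hfix : (fun i => if i = l then (-k : ℂ) else 1) ∘ Equiv.swap i j =
      fun i => if i = l then (-k : ℂ) else 1 := by
    funext m
    simp only [Function.comp_apply]
    congr 1
    rw [Equiv.swap_apply_eq_iff, Equiv.swap_apply_of_ne_of_ne hl.1 hl.2]
  have he := congrArg (eval (Fin.tail fun i => if i = l then (-k : ℂ) else 1)) hu
  rw [eval_permAct, hyperplanePoint_tail hsum, hfix, map_mul, eval_C] at he
  have ha : a = 1 :=
    mul_left_cancel₀ (eval_subsetSumProd_ne_zero l) (he.symm.trans (mul_one _).symm)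
  rw [hu, ha, C_1, mul_one]

theorem permAct_subsetSumProd (hk : 2 ≤ k) (σ : Equiv.Perm (Fin (k + 1))) :
    permAct σ (subsetSumProd k) = subsetSumProd k := by
  induction σ using Equiv.Perm.swap_induction_on with
  | one => exact permAct_one _
  | swap_mul f x y _ hf => rw [permAct_mul, hf, permAct_swap_subsetSumProd hk]

theorem restrSymmVanishing_eq_map (hk : 2 ≤ k) (m : ℕ) :
    restrSymmVanishing k (2 ^ k - 1 + m) =
      (restrSymm k m).map (LinearMap.mulLeft ℂ (subsetSumProd k)) := by
  ext p
  rw [mem_restrSymmVanishing, mem_restrSymm_iff_permAct, Submodule.mem_map]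
  constructor
  · rintro ⟨⟨hp, hσ⟩, u, rfl⟩
    refine ⟨u, mem_restrSymm_iff_permAct.2 ⟨isHomogeneous_of_mul (isHomogeneous_subsetSumProd k)
      (subsetSumProd_ne_zero k) hp, fun σ => ?_⟩, rfl⟩
    refine mul_left_cancel₀ (subsetSumProd_ne_zero k) ?_
    have := hσ σ
    rwa [map_mul, permAct_subsetSumProd hk] at this
  · rintro ⟨u, hu, rfl⟩
    obtain ⟨hu, hσ⟩ := mem_restrSymm_iff_permAct.1 hu
    refine ⟨⟨(isHomogeneous_subsetSumProd k).mul hu, fun σ => ?_⟩, u, rfl⟩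
    rw [LinearMap.mulLeft_apply, map_mul, permAct_subsetSumProd hk, hσ]

theorem restrSymmVanishing_eq_bot {g : ℕ} (hg : g < 2 ^ k - 1) : restrSymmVanishing k g = ⊥ := by
  rw [eq_bot_iff]
  intro p hp
  obtain ⟨hp, u, rfl⟩ := mem_restrSymmVanishing.1 hp
  exact eq_zero_of_mul_isHomogeneous (isHomogeneous_subsetSumProd k)
    (mem_restrSymm_iff_permAct.1 hp).1 hg

theorem finrank_restrSymmVanishing (hk : 2 ≤ k) {g : ℕ} (hg : 2 ^ k - 1 ≤ g) :
    Module.finrank ℂ (restrSymmVanishing k g) = NN (k + 1) (g - (2 ^ k - 1)) := by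
  obtain ⟨m, rfl⟩ := Nat.exists_eq_add_of_le hg
  rw [restrSymmVanishing_eq_map hk, ← LinearEquiv.finrank_eq (Submodule.equivMapOfInjective
    (LinearMap.mulLeft ℂ (subsetSumProd k))
    (mul_right_injective₀ (subsetSumProd_ne_zero k)) _), finrank_restrSymm, Nat.add_sub_cancel_left]

theorem restrSymmVanishing_one {g : ℕ} (hg : g ≠ 0) :
    restrSymmVanishing 1 g = restrSymm 1 g := by
  refine inf_eq_left.2 fun p hp => ?_
  rw [Submodule.restrictScalars_mem, Ideal.mem_span_singleton, subsetSumProd_dvd_iff]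
  rintro J ⟨j, hj⟩ y hy
  have hJ : J = {0} := by
    refine Finset.eq_singleton_iff_unique_mem.2 ⟨Subsingleton.elim j 0 ▸ hj, fun _ _ =>
      Subsingleton.elim _ _⟩
  have hy0 : y = 0 := by
    funext i
    rw [Subsingleton.elim i 0]
    simpa [hJ] using hy
  rw [hy0]
  have hc := (mem_restrSymm_iff_permAct.1 hp).1.coeff_eq_zero (d := 0) (by simpa using hg.symm)
  rwa [← constantCoeff_eq, ← eval_zero] at hc

theorem restrSymmVanishing_zero (g : ℕ) : restrSymmVanishing 0 g = restrSymm 0 g := by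
  refine inf_eq_left.2 fun p _ => ?_
  rw [Submodule.restrictScalars_mem, Ideal.mem_span_singleton, subsetSumProd_dvd_iff]
  rintro J ⟨j, -⟩
  exact j.elim0

theorem NN_one (g : ℕ) : NN 1 g = if g = 0 then 1 else 0 := by
  split_ifs with h
  · simp [NN, h]
  · simp [NN, Ne.symm h]

theorem NN_two (g : ℕ) : NN 2 g = if Even g then 1 else 0 := by
  have h : NN 2 g = Nat.card {d : ℕ // 2 * d = g} := by
    rw [NN, ← Nat.card_eq_finsetCard]
    refine Nat.card_congr ((Equiv.funUnique (Fin 1) ℕ).subtypeEquiv fun d => ?_)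
    simp [Fin.forall_fin_one]
    omega
  rw [h]
  split_ifs with hg
  · obtain ⟨r, rfl⟩ := hg
    refine Nat.card_eq_one_iff_unique.2 ⟨⟨fun a b => Subtype.ext ?_⟩, ⟨r, two_mul r⟩⟩
    have := a.2
    have := b.2
    omega
  · have : IsEmpty {d : ℕ // 2 * d = g} := ⟨fun d => hg ⟨d.1, by rw [← two_mul, d.2]⟩⟩
    exact Nat.card_of_isEmpty

end SubsetSumProd

/-- Stroh's Theorem: for `n > 2`, `dim_ℂ (S_{n,g}/Dec_{n,g})` is the
number of tuples `(k₂,…,kₙ)` with `2k₂+⋯+nkₙ = g - (2^{n-1}-1)` when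
`g ≥ 2^{n-1}-1`, and `0` when `g < 2^{n-1}-1`; for `n = 2` it is `1` iff `g` is even
and positive; for `n = 1` it is `1` iff `g = 0`. -/
theorem stmt13
    (D : Derivation ℂ (MvPolynomial ℕ ℂ) (MvPolynomial ℕ ℂ))
    (hD0 : D (X 0) = 0) (hD : ∀ i : ℕ, D (X (i + 1)) = X i)
    (n g : ℕ) :
    (2 < n →
      (2 ^ (n - 1) - 1 ≤ g →
        Module.finrank ℂ
            (↥(Sng D n g) ⧸ (Dec D n g).comap (Sng D n g).subtype) =
          NN n (g - (2 ^ (n - 1) - 1))) ∧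
      (g < 2 ^ (n - 1) - 1 →
        Module.finrank ℂ
            (↥(Sng D n g) ⧸ (Dec D n g).comap (Sng D n g).subtype) = 0)) ∧
    (n = 2 →
      Module.finrank ℂ (↥(Sng D n g) ⧸ (Dec D n g).comap (Sng D n g).subtype) =
        if Even g ∧ g ≠ 0 then 1 else 0) ∧
    (n = 1 →
      Module.finrank ℂ (↥(Sng D n g) ⧸ (Dec D n g).comap (Sng D n g).subtype) =
        if g = 0 then 1 else 0) := by
  refine ⟨fun hn => ?_, ?_, ?_⟩
  · obtain ⟨k, rfl⟩ := Nat.exists_eq_add_of_le' (Nat.one_le_of_lt hn)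
    rw [finrank_quotient_eq hD0 hD, Nat.add_sub_cancel]
    refine ⟨finrank_restrSymmVanishing (by omega), fun hg => ?_⟩
    rw [restrSymmVanishing_eq_bot hg, finrank_bot]
  · rintro rfl
    rw [finrank_quotient_eq hD0 hD]
    rcases eq_or_ne g 0 with rfl | hg
    · rw [restrSymmVanishing_eq_bot (by norm_num), finrank_bot]
      simp
    · rw [restrSymmVanishing_one hg, finrank_restrSymm, NN_two]
      simp [hg]
  · rintro rfl
    rw [finrank_quotient_eq hD0 hD, restrSymmVanishing_zero, finrank_restrSymm, NN_one]
end
end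

section
/- For n ≥ 2 and every (h₂,…,hₙ) ∈ ℕ^{n−1}, the leading exponent of ē₂^{h₂}⋯ēₙ^{hₙ} in ℂ[λ̄₁,…,λ̄_{n−1}] with respect to the lexicographic order is ℓexp(ē₂^{h₂}⋯ēₙ^{hₙ}) = (2(h₂+h₃+⋯+hₙ), h₃+⋯+hₙ, h₄+⋯+hₙ, …, h_{n−1}+hₙ, hₙ) ∈ ℕ^{n−1}. -/
open MvPolynomial

noncomputable section

/-- `λ̄ᵢ` (`i = 1,…,n`) in `Aₙ = ℂ[λ₁,…,λₙ]/(λ₁+⋯+λₙ)`, identified with the polynomial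
ring `ℂ[λ̄₁,…,λ̄_{n-1}]` via `λ̄ₙ = −(λ̄₁+⋯+λ̄_{n-1})`. -/
def lamb (n : ℕ) (i : Fin n) : MvPolynomial (Fin (n - 1)) ℂ :=
  if h : (i : ℕ) < n - 1 then X ⟨(i : ℕ), h⟩ else -(∑ j : Fin (n - 1), X j)

/-- `ēⱼ`: the image in `ℂ[λ̄₁,…,λ̄_{n-1}]` of the `j`-th elementary symmetric
polynomial `eⱼ(λ₁,…,λₙ)`. -/
def ebar (n j : ℕ) : MvPolynomial (Fin (n - 1)) ℂ :=
  ∑ T ∈ Finset.powersetCard j (Finset.univ : Finset (Fin n)), ∏ i ∈ T, lamb n i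

/-- `u ≤ v` in the lexicographic order on exponent vectors. -/
def lexLe {m : ℕ} (u v : Fin m → ℕ) : Prop :=
  u = v ∨ ∃ i : Fin m, u i < v i ∧ ∀ j : Fin m, j < i → u j = v j

/-- `v` is the leading exponent (`ℓexp`) of `f` for the lexicographic order:
the monomial with exponent `v` occurs in `f`, and every exponent occurring in `f`
is lexicographically `≤ v`. -/
def IsLeadExp {m : ℕ} (f : MvPolynomial (Fin m) ℂ) (v : Fin m → ℕ) : Prop :=
  coeff (Finsupp.equivFunOnFinite.symm v) f ≠ 0 ∧
    ∀ d ∈ f.support, lexLe (⇑d) v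

open scoped MonomialOrder

theorem Finset.esymm_cons_val {ι R : Type*} [CommSemiring R] (a : R) (f : ι → R) (s : Finset ι)
    (j : ℕ) :
    (a ::ₘ s.val.map f).esymm (j + 1) =
      (s.val.map f).esymm (j + 1) + a * (s.val.map f).esymm j := by
  simp only [Multiset.esymm, Multiset.powersetCard_cons, Multiset.map_add, Multiset.sum_add,
    Multiset.map_map, Function.comp_def, Multiset.prod_cons, Multiset.sum_map_mul_left]

theorem ebar_succ_eq (m j : ℕ) :
    ebar (m + 1) (j + 1) =
      esymm (Fin m) ℂ (j + 1) - esymm (Fin m) ℂ 1 * esymm (Fin m) ℂ j := by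
  have hu : (Finset.univ : Finset (Fin (m + 1))).val.map (lamb (m + 1)) =
      (-(∑ i : Fin m, X i)) ::ₘ (Finset.univ : Finset (Fin m)).val.map X := by
    rw [Fin.univ_castSuccEmb, Finset.cons_val, Multiset.map_cons, Finset.map_val, Multiset.map_map]
    congr 1
    · simp [lamb]
    · refine Multiset.map_congr rfl fun i _ => ?_
      simp [lamb]
  rw [ebar, ← Finset.esymm_map_val, hu, Finset.esymm_cons_val, esymm_one,
    esymm_eq_multiset_esymm]
  ring

theorem degree_lex_esymm {m : ℕ} (i : Fin m) :
    ⇑(MonomialOrder.lex.degree (esymm (Fin m) ℂ (i + 1))) =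
      fun j : Fin m => if j ≤ i then 1 else 0 := by
  have h := supDegree_esymm (R := ℂ) (n := m) i.2
  ext j
  have hj := congrFun h j
  simp only [Fin.accumulate_apply, Finsupp.single_apply, Finset.sum_ite_eq,
    Finset.mem_filter_univ] at hj
  exact hj

theorem degree_lex_ebar {k : ℕ} (i : Fin (k + 1)) :
    ⇑(MonomialOrder.lex.degree (σ := Fin (k + 1)) (ebar (k + 2) (i + 2))) =
      fun j : Fin (k + 1) => (if j = 0 then 1 else 0) + if j ≤ i then 1 else 0 := by
  have ne_zero (l : Fin (k + 1)) : esymm (Fin (k + 1)) ℂ (l + 1) ≠ 0 := by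
    refine MonomialOrder.lex.ne_zero_of_degree_ne_zero fun h => ?_
    have := congrFun (degree_lex_esymm l) 0
    simp [h] at this
  have hmul : ⇑(MonomialOrder.lex.degree
      (esymm (Fin (k + 1)) ℂ 1 * esymm (Fin (k + 1)) ℂ (i + 1))) =
      fun j : Fin (k + 1) => (if j = 0 then 1 else 0) + if j ≤ i then 1 else 0 := by
    have h0 := degree_lex_esymm (0 : Fin (k + 1))
    have hn0 := ne_zero 0
    simp only [Fin.val_zero, zero_add, Fin.le_zero_iff] at h0 hn0
    rw [MonomialOrder.degree_mul hn0 (ne_zero i), Finsupp.coe_add, h0, degree_lex_esymm]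
    rfl
  have hlt : MonomialOrder.lex.degree (esymm (Fin (k + 1)) ℂ (i + 1 + 1)) ≺[MonomialOrder.lex]
      MonomialOrder.lex.degree (esymm (Fin (k + 1)) ℂ 1 * esymm (Fin (k + 1)) ℂ (i + 1)) := by
    rw [MonomialOrder.lex_lt_iff]
    refine ⟨0, fun j hj => absurd hj (Fin.not_lt_zero j), ?_⟩
    simp only [ofLex_toLex, hmul, Fin.zero_le, if_true]
    by_cases hi : (i : ℕ) + 1 < k + 1
    · have := congrFun (degree_lex_esymm ⟨i + 1, hi⟩) 0
      simp only [Fin.zero_le, if_true] at this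
      omega
    · have : esymm (Fin (k + 1)) ℂ (i + 1 + 1) = 0 := by
        rw [esymm, Finset.powersetCard_eq_empty.2 (by simp; omega), Finset.sum_empty]
      simp [this]
  rw [ebar_succ_eq, ← MonomialOrder.degree_neg, neg_sub, MonomialOrder.degree_sub_of_lt hlt, hmul]

theorem isLeadExp_degree_lex {m : ℕ} {f : MvPolynomial (Fin m) ℂ} (hf : f ≠ 0) :
    IsLeadExp f (MonomialOrder.lex.degree f) := by
  refine ⟨?_, fun d hd => ?_⟩
  · simpa using hf
  · have h := MonomialOrder.lex.le_degree hd
    rw [MonomialOrder.lex_le_iff, le_iff_eq_or_lt] at h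
    rcases h with h | ⟨i, hi, hlt⟩
    · exact Or.inl (congrArg DFunLike.coe (toLex.injective h))
    · exact Or.inr ⟨i, hlt, hi⟩

theorem isLeadExp_prod_pow {k : ℕ} (f : Fin (k + 1) → MvPolynomial (Fin (k + 1)) ℂ)
    (hf : ∀ i, ⇑(MonomialOrder.lex.degree (f i)) =
      fun j => (if j = 0 then 1 else 0) + if j ≤ i then 1 else 0) (h : Fin (k + 1) → ℕ) :
    IsLeadExp (∏ i, f i ^ h i) (fun i => if (i : ℕ) = 0 then 2 * ∑ j, h j
      else ∑ j ∈ Finset.univ.filter (fun j : Fin (k + 1) => (i : ℕ) ≤ (j : ℕ)), h j) := by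
  have hpow (i : Fin (k + 1)) : f i ^ h i ≠ 0 := by
    refine pow_ne_zero _ (MonomialOrder.lex.ne_zero_of_degree_ne_zero fun h0 => ?_)
    have := congrFun (hf i) 0
    simp [h0] at this
  convert isLeadExp_degree_lex (Finset.prod_ne_zero_iff.2 fun i (_ : i ∈ Finset.univ) => hpow i)
    using 1
  rw [MonomialOrder.degree_prod fun i _ => hpow i]
  ext j
  simp only [MonomialOrder.degree_pow, Finsupp.coe_finsetSum, Finset.sum_apply,
    Finsupp.coe_smul, Pi.smul_apply, smul_eq_mul, hf]
  by_cases hj : j = 0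
  · simp [hj, ← Finset.sum_mul, mul_comm]
  · simp [hj, Finset.sum_filter]

/-- for `n ≥ 2` and `(h₂,…,hₙ) ∈ ℕ^{n-1}`,
`ℓexp(ē₂^{h₂}⋯ēₙ^{hₙ}) = (2(h₂+⋯+hₙ), h₃+⋯+hₙ, h₄+⋯+hₙ, …, h_{n-1}+hₙ, hₙ)`. -/
theorem stmt15 (n : ℕ) (hn : 2 ≤ n) (h : Fin (n - 1) → ℕ) :
    IsLeadExp (∏ i : Fin (n - 1), ebar n ((i : ℕ) + 2) ^ h i)
      (fun i : Fin (n - 1) =>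
        if (i : ℕ) = 0 then 2 * ∑ j : Fin (n - 1), h j
        else ∑ j ∈ Finset.univ.filter (fun j : Fin (n - 1) => (i : ℕ) ≤ (j : ℕ)), h j) := by
  obtain ⟨k, rfl⟩ := Nat.exists_eq_add_of_le' hn
  exact isLeadExp_prod_pow (k := k) (fun i => ebar (k + 2) (i + 2)) degree_lex_ebar h
end
end

section
/- For every n ≥ 2, the leading exponent of qₙ in ℂ[λ̄₁,…,λ̄_{n−1}] with respect to the lexicographic order is ℓexp(qₙ) = (2^{n−2}, 2^{n−3}, …, 2, 1). -/
open MvPolynomial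

noncomputable section

/-- `λ̄_T := ∑_{i∈T} λ̄ᵢ` for a subset `T ⊆ {1,…,n}`. -/
def lamT (n : ℕ) (T : Finset (Fin n)) : MvPolynomial (Fin (n - 1)) ℂ :=
  ∑ i ∈ T, lamb n i

/-- `p_h`: for `2h < n` the product of the `λ̄_T` over all `T` with `|T| = h`; for
`n = 2h` the product over those `T` with `|T| = h` containing the first index. -/
def pP (n h : ℕ) : MvPolynomial (Fin (n - 1)) ℂ :=
  if 2 * h < n then ∏ T ∈ Finset.powersetCard h (Finset.univ : Finset (Fin n)), lamT n T
  else ∏ T ∈ (Finset.powersetCard h (Finset.univ : Finset (Fin n))).filter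
      (fun T => ∃ i : Fin n, i ∈ T ∧ (i : ℕ) = 0), lamT n T

/-- `qₙ := p₁ p₂ ⋯ p_m`, `m = ⌊n/2⌋`. -/
def qP (n : ℕ) : MvPolynomial (Fin (n - 1)) ℂ :=
  ∏ h ∈ Finset.Icc 1 (n / 2), pP n h

theorem isLeadExp_of_degree_lex {m : ℕ} {f : MvPolynomial (Fin m) ℂ} {v : Fin m → ℕ}
    (hf : f ≠ 0) (hv : ⇑(MonomialOrder.lex.degree f) = v) : IsLeadExp f v := by
  subst hv
  refine ⟨?_, fun d hd => ?_⟩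
  · rw [show Finsupp.equivFunOnFinite.symm (⇑(MonomialOrder.lex.degree f)) =
      MonomialOrder.lex.degree f from Finsupp.ext fun _ => rfl]
    exact MonomialOrder.lex.coeff_degree_ne_zero_iff.mpr hf
  · have h := MonomialOrder.lex_le_iff.mp (MonomialOrder.lex.le_degree hd)
    rcases h.eq_or_lt with h | h
    · exact Or.inl (congrArg DFunLike.coe (toLex.injective h))
    · obtain ⟨i, hi, hlt⟩ := Finsupp.Lex.lt_iff.mp h
      exact Or.inr ⟨i, hlt, hi⟩

theorem coeff_single_sum_X {k : ℕ} (S : Finset (Fin k)) (i : Fin k) :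
    coeff (Finsupp.single i 1) (∑ j ∈ S, (X j : MvPolynomial (Fin k) ℂ)) =
      if i ∈ S then 1 else 0 := by
  classical
  simp [coeff_sum, coeff_X, Finsupp.single_left_inj]

theorem sum_X_ne_zero_s17 {k : ℕ} {S : Finset (Fin k)} (hS : S.Nonempty) :
    (∑ j ∈ S, (X j : MvPolynomial (Fin k) ℂ)) ≠ 0 := by
  obtain ⟨i, hi⟩ := hS
  intro h
  simpa [h, hi] using coeff_single_sum_X S i

theorem degree_lex_sum_X {k : ℕ} {S : Finset (Fin k)} (hS : S.Nonempty) :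
    MonomialOrder.lex.degree (∑ j ∈ S, (X j : MvPolynomial (Fin k) ℂ)) =
      Finsupp.single (S.min' hS) 1 := by
  classical
  apply MonomialOrder.lex.toSyn.injective
  apply le_antisymm
  · rw [MonomialOrder.degree_le_iff]
    intro c hc
    rw [mem_support_iff, coeff_sum] at hc
    obtain ⟨j, hj, hne⟩ := Finset.exists_ne_zero_of_sum_ne_zero hc
    rw [coeff_X, ne_eq, ite_eq_right_iff, Classical.not_imp] at hne
    rw [← hne.1, MonomialOrder.lex_le_iff, Finsupp.Lex.single_le_iff]
    exact S.min'_le j hj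
  · apply MonomialOrder.le_degree
    rw [mem_support_iff, coeff_single_sum_X, if_pos (S.min'_mem hS)]
    exact one_ne_zero

theorem card_filter_min'_eq {k : ℕ} (i : Fin k) :
    (Finset.univ.filter fun S : Finset (Fin k) => i ∈ S ∧ ∀ j ∈ S, i ≤ j).card =
      2 ^ (k - 1 - (i : ℕ)) := by
  classical
  rw [← Fin.card_Ioi, ← Finset.card_powerset]
  refine Finset.card_nbij' (fun S => S.erase i) (fun S => insert i S) ?_ ?_ ?_ ?_
  · intro S hS
    simp only [Finset.coe_filter, Finset.mem_univ, true_and, Set.mem_ofPred_eq] at hS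
    simp only [Finset.coe_powerset, Set.mem_preimage, Set.mem_powerset_iff]
    intro j hj
    simp only [Finset.coe_erase, Set.mem_sdiff, Finset.mem_coe, Set.mem_singleton_iff] at hj
    simpa using lt_of_le_of_ne (hS.2 j hj.1) (Ne.symm hj.2)
  · intro S hS
    rw [Finset.mem_coe, Finset.mem_powerset] at hS
    simp only [Finset.coe_filter, Finset.mem_univ, true_and, Set.mem_ofPred_eq,
      Finset.mem_insert_self, Finset.mem_insert, forall_eq_or_imp, le_refl]
    exact fun j hj => (Finset.mem_Ioi.mp (hS hj)).le
  · intro S hS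
    exact Finset.insert_erase (by simpa using (Finset.mem_filter.mp hS).2.1)
  · intro S hS
    rw [Finset.mem_coe, Finset.mem_powerset] at hS
    exact Finset.erase_insert fun h => lt_irrefl i (Finset.mem_Ioi.mp (hS h))

/-- The exponents of the leading monomials of all nonzero subset sums of the variables add up to
powers of two. -/
theorem sum_degree_lex_sum_X {k : ℕ} (i : Fin k) :
    ∑ S ∈ Finset.univ.filter (fun S : Finset (Fin k) => S.Nonempty),
      MonomialOrder.lex.degree (∑ j ∈ S, (X j : MvPolynomial (Fin k) ℂ)) i =
      2 ^ (k - 1 - (i : ℕ)) := by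
  classical
  rw [← card_filter_min'_eq, Finset.card_filter, Finset.sum_filter]
  refine Finset.sum_congr rfl fun S _ => ?_
  by_cases hS : S.Nonempty
  · rw [if_pos hS, degree_lex_sum_X hS, Finsupp.single_apply]
    refine if_congr ?_ rfl rfl
    rw [Finset.min'_eq_iff]
  · rw [if_neg hS, if_neg fun h => hS ⟨i, h.1⟩]

/-- Of the two complementary sets `T` and `Tᶜ`, the one avoiding the last index, viewed as a set
of indices of polynomial variables. -/
def avoidLast {k : ℕ} (T : Finset (Fin (k + 1))) : Finset (Fin k) :=
  Finset.univ.filter fun j => j.castSucc ∈ T ↔ Fin.last k ∉ T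

theorem lamT_eq {k : ℕ} (T : Finset (Fin (k + 1))) :
    lamT (k + 1) T = (if Fin.last k ∈ T then -1 else 1) * ∑ j ∈ avoidLast T, X j := by
  classical
  have hcast (j : Fin k) : lamb (k + 1) j.castSucc = X j := by
    simp [lamb]
  have hlast : lamb (k + 1) (Fin.last k) = -∑ j : Fin k, X j := by
    simp [lamb]
  have h : lamT (k + 1) T = ∑ i : Fin (k + 1), if i ∈ T then lamb (k + 1) i else 0 := by
    simp [lamT]
  rw [h, Fin.sum_univ_castSucc, avoidLast, Finset.sum_filter]
  by_cases hT : Fin.last k ∈ T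
  · simp only [hT, if_true, hcast, hlast, not_true_eq_false, iff_false, neg_mul, one_mul]
    rw [← sub_eq_add_neg, ← Finset.sum_sub_distrib, ← Finset.sum_neg_distrib]
    refine Finset.sum_congr rfl fun j _ => ?_
    split_ifs <;> simp
  · simp [hT, hcast]

/-- The index set of the factors of `qP n`. -/
def factorSets (n : ℕ) : Finset (Finset (Fin n)) :=
  Finset.univ.filter fun T => 1 ≤ T.card ∧ 2 * T.card ≤ n ∧
    (2 * T.card < n ∨ ∃ i : Fin n, i ∈ T ∧ (i : ℕ) = 0)

theorem qP_eq_prod (n : ℕ) : qP n = ∏ T ∈ factorSets n, lamT n T := by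
  classical
  rw [qP, ← Finset.prod_fiberwise_of_maps_to (t := Finset.Icc 1 (n / 2)) (g := Finset.card)]
  · refine Finset.prod_congr rfl fun h hh => ?_
    rw [Finset.mem_Icc] at hh
    rw [pP]
    split_ifs with hlt
    · refine Finset.prod_congr (Finset.ext fun T => ?_) fun _ _ => rfl
      simp only [factorSets, Finset.mem_filter, Finset.mem_univ, true_and,
        Finset.mem_powersetCard_univ]
      grind
    · refine Finset.prod_congr (Finset.ext fun T => ?_) fun _ _ => rfl
      simp only [factorSets, Finset.mem_filter, Finset.mem_univ, true_and,
        Finset.mem_powersetCard_univ]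
      constructor
      · rintro ⟨rfl, h0⟩
        exact ⟨⟨hh.1, by omega, Or.inr h0⟩, rfl⟩
      · rintro ⟨⟨_, _, h0⟩, rfl⟩
        exact ⟨rfl, h0.resolve_left hlt⟩
  · intro T hT
    have := (Finset.mem_filter.mp hT).2
    rw [Finset.mem_Icc]
    omega

theorem eq_or_eq_compl_of_avoidLast_eq {k : ℕ} {T U : Finset (Fin (k + 1))}
    (h : avoidLast T = avoidLast U) : T = U ∨ T = Uᶜ := by
  have h' (j : Fin k) : (j.castSucc ∈ T ↔ Fin.last k ∉ T) ↔ (j.castSucc ∈ U ↔ Fin.last k ∉ U) := by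
    simpa [avoidLast] using Finset.ext_iff.mp h j
  by_cases hl : Fin.last k ∈ T ↔ Fin.last k ∈ U
  · refine Or.inl (Finset.ext fun i => ?_)
    induction i using Fin.lastCases with
    | last => exact hl
    | cast j => have := h' j; tauto
  · refine Or.inr (Finset.ext fun i => ?_)
    rw [Finset.mem_compl]
    induction i using Fin.lastCases with
    | last => tauto
    | cast j => have := h' j; tauto

theorem mem_factorSets_or_compl_mem {n : ℕ} {T : Finset (Fin n)} (hT : T.Nonempty)
    (hT' : Tᶜ.Nonempty) : T ∈ factorSets n ∨ Tᶜ ∈ factorSets n := by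
  have h1 := hT.card_pos
  have h2 := hT'.card_pos
  have h3 := T.card_add_card_compl
  rw [Fintype.card_fin] at h3
  simp only [factorSets, Finset.mem_filter, Finset.mem_univ, true_and]
  rcases lt_trichotomy (2 * T.card) n with h | h | h
  · exact Or.inl ⟨by omega, by omega, Or.inl h⟩
  · let z : Fin n := ⟨0, by omega⟩
    by_cases hz : z ∈ T
    · exact Or.inl ⟨by omega, by omega, Or.inr ⟨z, hz, rfl⟩⟩
    · exact Or.inr ⟨by omega, by omega, Or.inr ⟨z, Finset.mem_compl.mpr hz, rfl⟩⟩
  · exact Or.inr ⟨by omega, by omega, Or.inl (by omega)⟩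

theorem compl_notMem_factorSets {n : ℕ} {T : Finset (Fin n)} (hT : T ∈ factorSets n) :
    Tᶜ ∉ factorSets n := by
  intro hT'
  simp only [factorSets, Finset.mem_filter, Finset.mem_univ, true_and] at hT hT'
  have h3 := T.card_add_card_compl
  rw [Fintype.card_fin] at h3
  obtain ⟨i, hi, hi0⟩ := hT.2.2.resolve_left (by omega)
  obtain ⟨j, hj, hj0⟩ := hT'.2.2.resolve_left (by omega)
  rw [Fin.ext (hj0.trans hi0.symm), Finset.mem_compl] at hj
  exact hj hi

theorem avoidLast_compl {k : ℕ} (T : Finset (Fin (k + 1))) : avoidLast Tᶜ = avoidLast T := by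
  ext j
  simp only [avoidLast, Finset.mem_filter, Finset.mem_univ, true_and, Finset.mem_compl]
  tauto

theorem avoidLast_map_castSucc {k : ℕ} (S : Finset (Fin k)) :
    avoidLast (S.map Fin.castSuccEmb) = S := by
  ext j
  simp [avoidLast, Fin.castSucc_ne_last]

theorem avoidLast_nonempty {k : ℕ} {T : Finset (Fin (k + 1))} (hT : T ∈ factorSets (k + 1)) :
    (avoidLast T).Nonempty := by
  have hc := (Finset.mem_filter.mp hT).2
  rw [Finset.nonempty_iff_ne_empty]
  intro h
  have h0 : avoidLast T = avoidLast (∅ : Finset (Fin (k + 1))) := by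
    rw [h]; ext j; simp [avoidLast]
  rcases eq_or_eq_compl_of_avoidLast_eq h0 with rfl | rfl
  · simp at hc
  · simp at hc

theorem sum_factorSets_avoidLast {k : ℕ} (g : Finset (Fin k) → ℕ) :
    ∑ T ∈ factorSets (k + 1), g (avoidLast T) =
      ∑ S ∈ Finset.univ.filter (fun S : Finset (Fin k) => S.Nonempty), g S := by
  refine Finset.sum_bij (fun T _ => avoidLast T) ?_ ?_ ?_ fun _ _ => rfl
  · exact fun T hT => Finset.mem_filter.mpr ⟨Finset.mem_univ _, avoidLast_nonempty hT⟩
  · intro T hT U hU h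
    refine (eq_or_eq_compl_of_avoidLast_eq h).resolve_right ?_
    rintro rfl
    exact compl_notMem_factorSets hU hT
  · intro S hS
    have hne : (S.map Fin.castSuccEmb).Nonempty := by simpa using hS
    have hne' : (S.map Fin.castSuccEmb)ᶜ.Nonempty :=
      ⟨Fin.last k, by simp [Fin.castSucc_ne_last]⟩
    rcases mem_factorSets_or_compl_mem hne hne' with h | h
    · exact ⟨_, h, avoidLast_map_castSucc S⟩
    · exact ⟨_, h, (avoidLast_compl _).trans (avoidLast_map_castSucc S)⟩

theorem lamT_ne_zero {k : ℕ} {T : Finset (Fin (k + 1))} (hT : T ∈ factorSets (k + 1)) :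
    lamT (k + 1) T ≠ 0 := by
  have h := sum_X_ne_zero_s17 (avoidLast_nonempty hT)
  rw [lamT_eq]
  split_ifs
  · rw [neg_one_mul]
    exact neg_ne_zero.mpr h
  · rwa [one_mul]

theorem degree_lex_lamT {k : ℕ} (T : Finset (Fin (k + 1))) :
    MonomialOrder.lex.degree (lamT (k + 1) T) =
      MonomialOrder.lex.degree (∑ j ∈ avoidLast T, (X j : MvPolynomial (Fin k) ℂ)) := by
  rw [lamT_eq]
  split_ifs
  · rw [neg_one_mul]
    exact MonomialOrder.degree_neg
  · rw [one_mul]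

/-- for `n ≥ 2`, `ℓexp(qₙ) = (2^{n-2}, 2^{n-3}, …, 2, 1)`. -/
theorem stmt17 (n : ℕ) (hn : 2 ≤ n) :
    IsLeadExp (qP n) (fun i : Fin (n - 1) => 2 ^ (n - 2 - (i : ℕ))) := by
  obtain ⟨k, rfl⟩ : ∃ k, n = k + 1 := ⟨n - 1, by omega⟩
  rw [qP_eq_prod]
  apply isLeadExp_of_degree_lex
  · exact Finset.prod_ne_zero_iff.mpr fun T hT => lamT_ne_zero hT
  · rw [MonomialOrder.degree_prod fun T hT => lamT_ne_zero hT]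
    funext i
    rw [Finsupp.finsetSum_apply, Finset.sum_congr rfl fun T _ => by rw [degree_lex_lamT]]
    exact (sum_factorSets_avoidLast _).trans (sum_degree_lex_sum_X i)
end
end
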